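/- arXiv:2510.00121 — 3 statements merged into one kernel-verified Lean document; each statement's English description precedes it below -/
import Mathlib

section
/- If f : ℝ⁺ → ℝ is operator monotone of order 2n (i.e., A ≤ B implies f(A) ≤ f(B) for all 2n×2n Hermitian matrices A, B with spectra in ℝ⁺), then f is operator concave of order n: f(λA + (1−λ)B) ≥ λf(A) + (1−λ)f(B) for all n×n Hermitian A, B with spectra in ℝ⁺ and λ ∈ [0,1]. -/
open Set
open scoped ComplexOrder

/-- Apply a real function to a Hermitian matrix via its spectral decomposition. -/
noncomputable def hermApply {n : ℕ} (f : ℝ → ℝ) (A : Matrix (Fin n) (Fin n) ℂ)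
    (hA : A.IsHermitian) : Matrix (Fin n) (Fin n) ℂ :=
  (hA.eigenvectorUnitary : Matrix (Fin n) (Fin n) ℂ) *
    Matrix.diagonal (fun i => (f (hA.eigenvalues i) : ℂ)) *
    star (hA.eigenvectorUnitary : Matrix (Fin n) (Fin n) ℂ)

open Matrix in
/-- Functional calculus along any (rectangular) diagonalizing intertwiner. -/
lemma hermApply_mul_diag {m k : ℕ} (f : ℝ → ℝ) (A : Matrix (Fin m) (Fin m) ℂ)
    (hA : A.IsHermitian) (U : Matrix (Fin m) (Fin k) ℂ) (d : Fin k → ℝ)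
    (h : A * U = U * Matrix.diagonal (fun i => (d i : ℂ))) :
    hermApply f A hA * U = U * Matrix.diagonal (fun i => (f (d i) : ℂ)) := by
  set W : Matrix (Fin m) (Fin m) ℂ := (hA.eigenvectorUnitary : Matrix (Fin m) (Fin m) ℂ) with hW
  have hWW : star W * W = 1 := Unitary.coe_star_mul_self hA.eigenvectorUnitary
  have hWW' : W * star W = 1 := Unitary.coe_mul_star_self hA.eigenvectorUnitary
  have hspec : A = W * Matrix.diagonal (fun i => (hA.eigenvalues i : ℂ)) * star W := by
    have := hA.spectral_theorem
    rw [Unitary.conjStarAlgAut_apply] at this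
    exact this
  have h1 : Matrix.diagonal (fun i => (hA.eigenvalues i : ℂ)) * (star W * U)
      = (star W * U) * Matrix.diagonal (fun i => (d i : ℂ)) := by
    calc Matrix.diagonal (fun i => (hA.eigenvalues i : ℂ)) * (star W * U)
        = (star W * W) * Matrix.diagonal (fun i => (hA.eigenvalues i : ℂ)) * (star W * U) := by
          rw [hWW, Matrix.one_mul]
      _ = star W * ((W * Matrix.diagonal (fun i => (hA.eigenvalues i : ℂ)) * star W) * U) := by
          simp only [Matrix.mul_assoc]
      _ = star W * (A * U) := by rw [← hspec]
      _ = _ := by rw [h, Matrix.mul_assoc]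
  have h2 : Matrix.diagonal (fun i => (f (hA.eigenvalues i) : ℂ)) * (star W * U)
      = (star W * U) * Matrix.diagonal (fun i => (f (d i) : ℂ)) := by
    ext i j
    have := congrFun (congrFun h1 i) j
    rw [Matrix.diagonal_mul, Matrix.mul_diagonal] at this ⊢
    by_cases hq : (star W * U) i j = 0
    · rw [hq]; simp
    · have h3 : (hA.eigenvalues i : ℂ) = (d j : ℂ) := by
        apply mul_right_cancel₀ hq; rw [this, mul_comm]
      have h4 : hA.eigenvalues i = d j := by exact_mod_cast h3
      rw [h4, mul_comm]
  unfold hermApply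
  rw [← hW, Matrix.mul_assoc, Matrix.mul_assoc, h2, ← Matrix.mul_assoc, ← Matrix.mul_assoc, hWW',
    Matrix.one_mul]

/-- Functional calculus respects rectangular intertwiners. -/
lemma hermApply_intertwine {m k : ℕ} (f : ℝ → ℝ) (A : Matrix (Fin m) (Fin m) ℂ)
    (hA : A.IsHermitian) (B : Matrix (Fin k) (Fin k) ℂ) (hB : B.IsHermitian)
    (X : Matrix (Fin m) (Fin k) ℂ) (h : A * X = X * B) :
    hermApply f A hA * X = X * hermApply f B hB := by
  set W : Matrix (Fin k) (Fin k) ℂ := (hB.eigenvectorUnitary : Matrix (Fin k) (Fin k) ℂ) with hW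
  have hWW : star W * W = 1 := Unitary.coe_star_mul_self hB.eigenvectorUnitary
  have hWW' : W * star W = 1 := Unitary.coe_mul_star_self hB.eigenvectorUnitary
  have hspec : B = W * Matrix.diagonal (fun i => (hB.eigenvalues i : ℂ)) * star W := by
    have := hB.spectral_theorem
    rw [Unitary.conjStarAlgAut_apply] at this
    exact this
  have h1 : B * W = W * Matrix.diagonal (fun i => (hB.eigenvalues i : ℂ)) := by
    conv_lhs => rw [hspec]
    rw [Matrix.mul_assoc, hWW, Matrix.mul_one]
  have h2 := hermApply_mul_diag f A hA (X * W) hB.eigenvalues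
    (by rw [← Matrix.mul_assoc, h, Matrix.mul_assoc, h1, Matrix.mul_assoc])
  calc hermApply f A hA * X = hermApply f A hA * (X * W) * star W := by
        rw [Matrix.mul_assoc, Matrix.mul_assoc, hWW', Matrix.mul_one]
    _ = X * hermApply f B hB := by
        rw [h2]; unfold hermApply; rw [← hW]; simp only [Matrix.mul_assoc]

lemma hermApply_smul_one {m : ℕ} (f : ℝ → ℝ) (a : ℝ)
    (hA : ((a : ℂ) • (1 : Matrix (Fin m) (Fin m) ℂ)).IsHermitian) :
    hermApply f _ hA = (f a : ℂ) • (1 : Matrix (Fin m) (Fin m) ℂ) := by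
  have := hermApply_mul_diag f _ hA 1 (fun _ => a) (by
    rw [Matrix.one_mul, Matrix.mul_one, Matrix.smul_one_eq_diagonal])
  rw [Matrix.mul_one, Matrix.one_mul] at this
  rw [this, Matrix.smul_one_eq_diagonal]

open Matrix in
lemma posDef_block {m k : ℕ} (A B : Matrix (Fin k) (Fin k) ℂ) (hA : A.PosDef) (hB : B.PosDef)
    (Y Z : Matrix (Fin m) (Fin k) ℂ) (h : Y * Yᴴ + Z * Zᴴ = 1) :
    (Y * A * Yᴴ + Z * B * Zᴴ).PosDef := by
  have p1 := hA.posSemidef.mul_mul_conjTranspose_same Y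
  have p2 := hB.posSemidef.mul_mul_conjTranspose_same Z
  refine Matrix.PosDef.of_dotProduct_mulVec_pos (p1.add p2).isHermitian ?_
  intro x hx
  have key : ∀ (M : Matrix (Fin k) (Fin k) ℂ) (V : Matrix (Fin m) (Fin k) ℂ),
      star x ⬝ᵥ ((V * M * Vᴴ) *ᵥ x) = star (Vᴴ *ᵥ x) ⬝ᵥ (M *ᵥ (Vᴴ *ᵥ x)) := by
    intro M V
    rw [Matrix.star_mulVec, Matrix.conjTranspose_conjTranspose, ← Matrix.dotProduct_mulVec,
      Matrix.mulVec_mulVec, Matrix.mulVec_mulVec, Matrix.mul_assoc]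
  rw [Matrix.add_mulVec, dotProduct_add, key, key]
  by_cases hy : Yᴴ *ᵥ x = 0
  · have hz : Zᴴ *ᵥ x ≠ 0 := by
      intro hz
      apply hx
      have : (Y * Yᴴ + Z * Zᴴ) *ᵥ x = x := by rw [h, Matrix.one_mulVec]
      rw [← this, Matrix.add_mulVec, ← Matrix.mulVec_mulVec, ← Matrix.mulVec_mulVec, hy, hz]
      simp
    exact add_pos_of_nonneg_of_pos (hA.posSemidef.dotProduct_mulVec_nonneg _)
      (hB.dotProduct_mulVec_pos hz)
  · exact add_pos_of_pos_of_nonneg (hA.dotProduct_mulVec_pos hy)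
      (hB.posSemidef.dotProduct_mulVec_nonneg _)

open Matrix in
lemma exists_isometries (n : ℕ) : ∃ X Y : Matrix (Fin (2 * n)) (Fin n) ℂ,
    Xᴴ * X = 1 ∧ Yᴴ * Y = 1 ∧ Xᴴ * Y = 0 ∧ Yᴴ * X = 0 ∧ X * Xᴴ + Y * Yᴴ = 1 := by
  let e : Fin n ⊕ Fin n ≃ Fin (2 * n) := finSumFinEquiv.trans (finCongr (by ring))
  let X : Matrix (Fin (2 * n)) (Fin n) ℂ :=
    (1 : Matrix (Fin n ⊕ Fin n) (Fin n ⊕ Fin n) ℂ).submatrix e.symm Sum.inl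
  let Y : Matrix (Fin (2 * n)) (Fin n) ℂ :=
    (1 : Matrix (Fin n ⊕ Fin n) (Fin n ⊕ Fin n) ℂ).submatrix e.symm Sum.inr
  refine ⟨X, Y, ?_, ?_, ?_, ?_, ?_⟩
  iterate 4
    · simp only [X, Y, Matrix.conjTranspose_submatrix, Matrix.conjTranspose_one,
        Matrix.submatrix_mul_equiv, Matrix.mul_one]
      ext i j
      simp [Matrix.one_apply]
  · ext i j
    obtain ⟨i, rfl⟩ := e.surjective i
    obtain ⟨j, rfl⟩ := e.surjective j
    rcases i with i | i <;> rcases j with j | j <;>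
      simp [X, Y, Matrix.mul_apply, Matrix.one_apply, eq_comm]

open Matrix in
lemma concave_eps {n : ℕ} (f : ℝ → ℝ)
    (hmono : ∀ (A B : Matrix (Fin (2 * n)) (Fin (2 * n)) ℂ)
      (hA : A.IsHermitian) (hB : B.IsHermitian),
      (∀ i, 0 < hA.eigenvalues i) → (∀ i, 0 < hB.eigenvalues i) →
      (B - A).PosSemidef → (hermApply f B hB - hermApply f A hA).PosSemidef)
    (A B : Matrix (Fin n) (Fin n) ℂ) (hA : A.PosDef) (hB : B.PosDef)
    (l : ℝ) (hl : l ∈ Icc (0 : ℝ) 1) (ε : ℝ) (hε : 0 < ε)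
    (hC : (((l : ℂ) • A + ((1 - l : ℝ) : ℂ) • B) + (ε : ℂ) • 1).IsHermitian) :
    (hermApply f _ hC - ((l : ℂ) • hermApply f A hA.isHermitian
      + ((1 - l : ℝ) : ℂ) • hermApply f B hB.isHermitian)).PosSemidef := by
  obtain ⟨X, Y, hXX, hYY, hXY, hYX, hsum⟩ := exists_isometries n
  obtain ⟨s, hs⟩ : ∃ s : ℝ, s * s = l := ⟨√l, Real.mul_self_sqrt hl.1⟩
  obtain ⟨t, ht⟩ : ∃ t : ℝ, t * t = 1 - l := ⟨√(1 - l), Real.mul_self_sqrt (by linarith [hl.2])⟩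
  have hs' : (s : ℂ) * s = (l : ℂ) := by exact_mod_cast hs
  have ht' : (t : ℂ) * t = ((1 - l : ℝ) : ℂ) := by exact_mod_cast ht
  have hst : (s : ℂ) * s + t * t = 1 := by rw [hs', ht']; push_cast; ring
  have hts : (t : ℂ) * t + s * s = 1 := by rw [hs', ht']; push_cast; ring
  revert hC
  rw [← hs', ← ht']
  intro hC
  set P := (s : ℂ) • X - (t : ℂ) • Y with hP
  set Q := (t : ℂ) • X + (s : ℂ) • Y with hQ
  have hPH : Pᴴ = (s : ℂ) • Xᴴ - (t : ℂ) • Yᴴ := by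
    simp [hP, Matrix.conjTranspose_sub, Matrix.conjTranspose_smul]
  have hQH : Qᴴ = (t : ℂ) • Xᴴ + (s : ℂ) • Yᴴ := by
    simp [hQ, Matrix.conjTranspose_add, Matrix.conjTranspose_smul]
  have hPP : Pᴴ * P = 1 := by
    rw [hPH, hP]
    simp only [Matrix.sub_mul, Matrix.mul_sub, Matrix.smul_mul, Matrix.mul_smul, hXX, hYY, hXY, hYX]
    conv_rhs => rw [← one_smul ℂ (1 : Matrix (Fin n) (Fin n) ℂ), ← hst]
    module
  have hQQ : Qᴴ * Q = 1 := by
    rw [hQH, hQ]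
    simp only [Matrix.add_mul, Matrix.mul_add, Matrix.smul_mul, Matrix.mul_smul, hXX, hYY, hXY, hYX]
    conv_rhs => rw [← one_smul ℂ (1 : Matrix (Fin n) (Fin n) ℂ), ← hst]
    module
  have hPQ : Pᴴ * Q = 0 := by
    rw [hPH, hQ]
    simp only [Matrix.sub_mul, Matrix.mul_add, Matrix.smul_mul, Matrix.mul_smul, hXX, hYY, hXY, hYX]
    module
  have hQP : Qᴴ * P = 0 := by
    rw [hQH, hP]
    simp only [Matrix.add_mul, Matrix.mul_sub, Matrix.smul_mul, Matrix.mul_smul, hXX, hYY, hXY, hYX]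
    module
  have hPQsum : P * Pᴴ + Q * Qᴴ = 1 := by
    rw [hPH, hQH, hP, hQ, ← hsum]
    simp only [Matrix.add_mul, Matrix.mul_sub, Matrix.sub_mul, Matrix.mul_add, Matrix.smul_mul,
      Matrix.mul_smul]
    conv_rhs => rw [← one_smul ℂ (X * Xᴴ), ← one_smul ℂ (Y * Yᴴ), ← hst]
    module
  have hXPQ : X = (s : ℂ) • P + (t : ℂ) • Q := by
    rw [hP, hQ]
    conv_lhs => rw [← one_smul ℂ X, ← hst]
    module
  have hXP : Xᴴ * P = (s : ℂ) • 1 := by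
    rw [hP]; simp only [Matrix.mul_sub, Matrix.mul_smul, hXX, hXY]; module
  have hXQ : Xᴴ * Q = (t : ℂ) • 1 := by
    rw [hQ]; simp only [Matrix.mul_add, Matrix.mul_smul, hXX, hXY]; module
  set T := P * A * Pᴴ + Q * B * Qᴴ with hT
  have hTpos : T.PosDef := posDef_block A B hA hB P Q hPQsum
  have hTP : T * P = P * A := by
    rw [hT, Matrix.add_mul, Matrix.mul_assoc _ Pᴴ, hPP, Matrix.mul_assoc _ Qᴴ, hQP]; simp
  have hTQ : T * Q = Q * B := by
    rw [hT, Matrix.add_mul, Matrix.mul_assoc _ Pᴴ, hPQ, Matrix.mul_assoc _ Qᴴ, hQQ]; simp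
  have nn : ∀ r : ℝ, (0 : ℂ) ≤ (r : ℂ) * r := by
    intro r; exact_mod_cast mul_self_nonneg r
  have hεC : (0 : ℂ) < (ε : ℂ) := by exact_mod_cast hε
  have hεi : (0 : ℂ) ≤ ((ε⁻¹ : ℝ) : ℂ) := by exact_mod_cast (inv_pos.2 hε).le
  set C := ((s : ℂ) * s) • A + ((t : ℂ) * t) • B + (ε : ℂ) • 1 with hCdef
  have hCpos : C.PosDef :=
    Matrix.PosDef.posSemidef_add ((hA.posSemidef.smul (nn s)).add (hB.posSemidef.smul (nn t)))
      (Matrix.PosDef.one.smul hεC)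
  set H := ((s : ℂ) * t) • (A - B) with hH
  have hHH : Hᴴ = H := by
    simp [hH, Matrix.conjTranspose_smul, Matrix.conjTranspose_sub, hA.isHermitian.eq,
      hB.isHermitian.eq]
  set Z := ((t : ℂ) * t) • A + ((s : ℂ) * s) • B + ((ε⁻¹ : ℝ) : ℂ) • (H * Hᴴ) + 1 with hZ
  have hZpos : Z.PosDef :=
    Matrix.PosDef.posSemidef_add (((hA.posSemidef.smul (nn t)).add (hB.posSemidef.smul (nn s))).add
      ((Matrix.posSemidef_self_mul_conjTranspose H).smul hεi)) Matrix.PosDef.one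
  set S := X * C * Xᴴ + Y * Z * Yᴴ with hS
  have hSpos : S.PosDef := posDef_block C Z hCpos hZpos X Y hsum
  have hSX : S * X = X * C := by
    rw [hS, Matrix.add_mul, Matrix.mul_assoc _ Xᴴ, hXX, Matrix.mul_assoc _ Yᴴ, hYX]; simp
  have hST : S - T = ((ε⁻¹ : ℝ) : ℂ) • (((ε : ℂ) • X + Y * H) * ((ε : ℂ) • X + Y * H)ᴴ)
      + Y * Yᴴ := by
    have e1 : ((ε : ℂ) • X + Y * H)ᴴ = (ε : ℂ) • Xᴴ + H * Yᴴ := by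
      simp [Matrix.conjTranspose_add, Matrix.conjTranspose_smul, Matrix.conjTranspose_mul, hHH]
    have e2 : ((ε⁻¹ : ℝ) : ℂ) * (ε : ℂ) = 1 := by
      exact_mod_cast inv_mul_cancel₀ hε.ne'
    rw [e1]
    have e3 : ((ε⁻¹ : ℝ) : ℂ) • (((ε : ℂ) • X + Y * H) * ((ε : ℂ) • Xᴴ + H * Yᴴ))
      = (ε : ℂ) • (X * Xᴴ) + X * H * Yᴴ + Y * H * Xᴴ
        + ((ε⁻¹ : ℝ) : ℂ) • (Y * (H * H) * Yᴴ) := by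
      simp only [Matrix.add_mul, Matrix.mul_add, Matrix.smul_mul, Matrix.mul_smul, smul_add,
        smul_smul, ← mul_assoc, e2, one_mul, one_smul, Matrix.mul_assoc]
      abel
    rw [e3, hS, hT, hZ, hHH, hCdef, hPH, hQH, hP, hQ]
    generalize H * H = HH
    rw [hH]
    simp only [Matrix.add_mul, Matrix.mul_sub, Matrix.sub_mul, Matrix.mul_add, Matrix.smul_mul,
      Matrix.mul_smul, Matrix.mul_one]
    module
  have hSTpos : (S - T).PosSemidef := by
    rw [hST]
    exact ((Matrix.posSemidef_self_mul_conjTranspose _).smul hεi).add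
      (Matrix.posSemidef_self_mul_conjTranspose _)
  have hfin := hmono T S hTpos.isHermitian hSpos.isHermitian
    (hTpos.isHermitian.posDef_iff_eigenvalues_pos.1 hTpos)
    (hSpos.isHermitian.posDef_iff_eigenvalues_pos.1 hSpos) hSTpos
  have hc := hfin.conjTranspose_mul_mul_same X
  have i1 := hermApply_intertwine f S hSpos.isHermitian C hC X hSX
  have i2 := hermApply_intertwine f T hTpos.isHermitian A hA.isHermitian P hTP
  have i3 := hermApply_intertwine f T hTpos.isHermitian B hB.isHermitian Q hTQ
  convert hc using 1
  rw [Matrix.mul_assoc, Matrix.sub_mul, i1, Matrix.mul_sub, ← Matrix.mul_assoc, hXX, Matrix.one_mul]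
  congr 1
  conv_rhs => rw [show hermApply f T hTpos.isHermitian * X
    = hermApply f T hTpos.isHermitian * ((s : ℂ) • P + (t : ℂ) • Q) from by rw [← hXPQ]]
  rw [Matrix.mul_add, Matrix.mul_smul, Matrix.mul_smul, i2, i3, Matrix.mul_add, Matrix.mul_smul,
    Matrix.mul_smul, ← Matrix.mul_assoc, ← Matrix.mul_assoc, hXP, hXQ, Matrix.smul_mul,
    Matrix.smul_mul, Matrix.one_mul, Matrix.one_mul, smul_smul, smul_smul]

lemma scalar_eps {n : ℕ} (i₀ : Fin n) (f : ℝ → ℝ)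
    (hmono : ∀ (A B : Matrix (Fin (2 * n)) (Fin (2 * n)) ℂ)
      (hA : A.IsHermitian) (hB : B.IsHermitian),
      (∀ i, 0 < hA.eigenvalues i) → (∀ i, 0 < hB.eigenvalues i) →
      (B - A).PosSemidef → (hermApply f B hB - hermApply f A hA).PosSemidef)
    (a b c l : ℝ) (ha : 0 < a) (hb : 0 < b) (hl : l ∈ Icc (0 : ℝ) 1)
    (hc : l * a + (1 - l) * b < c) : l * f a + (1 - l) * f b ≤ f c := by
  have pd : ∀ r : ℝ, 0 < r → ((r : ℂ) • (1 : Matrix (Fin n) (Fin n) ℂ)).PosDef := by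
    intro r hr
    exact Matrix.PosDef.one.smul (by exact_mod_cast hr)
  have hcp : 0 < c := lt_of_le_of_lt
    (add_nonneg (mul_nonneg hl.1 ha.le) (mul_nonneg (by linarith [hl.2]) hb.le)) hc
  have heq : ((l : ℂ) • ((a : ℂ) • (1 : Matrix (Fin n) (Fin n) ℂ)) + ((1 - l : ℝ) : ℂ) •
      ((b : ℂ) • (1 : Matrix (Fin n) (Fin n) ℂ))) +
      ((c - (l * a + (1 - l) * b) : ℝ) : ℂ) • (1 : Matrix (Fin n) (Fin n) ℂ)
      = (c : ℂ) • (1 : Matrix (Fin n) (Fin n) ℂ) := by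
    push_cast; module
  have h := concave_eps f hmono _ _ (pd a ha) (pd b hb) l hl (c - (l * a + (1 - l) * b))
    (by linarith) (by rw [heq]; exact (pd c hcp).isHermitian)
  have key : ∀ (M : Matrix (Fin n) (Fin n) ℂ) (hM : M.IsHermitian),
      M = (c : ℂ) • (1 : Matrix (Fin n) (Fin n) ℂ) →
      hermApply f M hM = (f c : ℂ) • (1 : Matrix (Fin n) (Fin n) ℂ) := by
    intro M hM hMe
    subst hMe
    exact hermApply_smul_one f c hM
  rw [key _ _ heq, hermApply_smul_one, hermApply_smul_one] at h
  have := h.diag_nonneg (i := i₀)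
  simp at this
  have h3 : ((l * f a + (1 - l) * f b : ℝ) : ℂ) ≤ ((f c : ℝ) : ℂ) := by
    push_cast
    simpa using this
  exact_mod_cast h3

/-- Operator monotone of order 2n implies operator concave of order n
(for functions on the positive half-line). -/
theorem matrixMonotone_two_mul_imp_matrixConcave {n : ℕ} (f : ℝ → ℝ)
    (hmono : ∀ (A B : Matrix (Fin (2 * n)) (Fin (2 * n)) ℂ)
      (hA : A.IsHermitian) (hB : B.IsHermitian),
      (∀ i, 0 < hA.eigenvalues i) → (∀ i, 0 < hB.eigenvalues i) →
      (B - A).PosSemidef → (hermApply f B hB - hermApply f A hA).PosSemidef) :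
    ∀ (A B : Matrix (Fin n) (Fin n) ℂ) (hA : A.IsHermitian) (hB : B.IsHermitian),
      (∀ i, 0 < hA.eigenvalues i) → (∀ i, 0 < hB.eigenvalues i) →
      ∀ l ∈ Icc (0:ℝ) 1, ∀ hC : (l • A + (1 - l) • B).IsHermitian,
        (hermApply f (l • A + (1 - l) • B) hC -
          (l • hermApply f A hA + (1 - l) • hermApply f B hB)).PosSemidef := by
  intro A B hA hB hAe hBe l hl
  have hAp : A.PosDef := hA.posDef_iff_eigenvalues_pos.2 hAe
  have hBp : B.PosDef := hB.posDef_iff_eigenvalues_pos.2 hBe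
  have conv : ∀ (r : ℝ) (M : Matrix (Fin n) (Fin n) ℂ), r • M = (r : ℂ) • M := by
    intro r M; ext i j; simp
  simp only [conv]
  intro hC
  set C := (l : ℂ) • A + ((1 - l : ℝ) : ℂ) • B with hCdef
  set R := (l : ℂ) • hermApply f A hA + ((1 - l : ℝ) : ℂ) • hermApply f B hB with hR
  have hl0 : (0 : ℂ) ≤ (l : ℂ) := by exact_mod_cast hl.1
  have hl1 : (0 : ℂ) ≤ ((1 - l : ℝ) : ℂ) := by
    have : (0 : ℝ) ≤ 1 - l := by linarith [hl.2]
    exact_mod_cast this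
  have hCp : C.PosDef := by
    rcases hl0.eq_or_lt with h | h
    · have : l = 0 := by exact_mod_cast h.symm
      have hCB : C = B := by rw [hCdef, this]; simp
      rw [hCB]; exact hBp
    · exact (hAp.smul h).add_posSemidef (hBp.posSemidef.smul hl1)
  have hce := hC.posDef_iff_eigenvalues_pos.1 hCp
  set W : Matrix (Fin n) (Fin n) ℂ := (hC.eigenvectorUnitary : Matrix (Fin n) (Fin n) ℂ) with hW
  have hWW : star W * W = 1 := Unitary.coe_star_mul_self hC.eigenvectorUnitary
  have hWW' : W * star W = 1 := Unitary.coe_mul_star_self hC.eigenvectorUnitary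
  have hspec : C = W * Matrix.diagonal (fun i => (hC.eigenvalues i : ℂ)) * star W := by
    have := hC.spectral_theorem
    rw [Unitary.conjStarAlgAut_apply] at this
    exact this
  have hCW : C * W = W * Matrix.diagonal (fun i => (hC.eigenvalues i : ℂ)) := by
    conv_lhs => rw [hspec]
    rw [Matrix.mul_assoc, hWW, Matrix.mul_one]
  let g : ℝ → Fin n → ℝ := fun ε i =>
    (f (hC.eigenvalues i) - (4 * ε / hC.eigenvalues i) * f (hC.eigenvalues i / 2))
      / (1 - 4 * ε / hC.eigenvalues i)
  have hg : ∀ ε > 0, ∀ i, 4 * ε < hC.eigenvalues i → f (hC.eigenvalues i + ε) ≤ g ε i := by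
    intro ε hε i hi
    have hc := hce i
    have hq : 4 * ε / hC.eigenvalues i < 1 := by rw [div_lt_one hc]; exact hi
    have hq0 : 0 < 4 * ε / hC.eigenvalues i := by positivity
    have hqc : 4 * ε / hC.eigenvalues i * hC.eigenvalues i = 4 * ε := div_mul_cancel₀ _ hc.ne'
    have := scalar_eps i f hmono (hC.eigenvalues i / 2) (hC.eigenvalues i + ε) (hC.eigenvalues i)
      (4 * ε / hC.eigenvalues i) (by positivity) (by positivity) ⟨hq0.le, hq.le⟩
      (by nlinarith [mul_pos hq0 hε])
    simp only [g]
    rw [le_div_iff₀ (by linarith)]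
    linarith
  have hpsd : ∀ ε > 0, (∀ i, 4 * ε < hC.eigenvalues i) →
      (W * Matrix.diagonal (fun i => (g ε i : ℂ)) * star W - R).PosSemidef := by
    intro ε hε hi
    have hCε : (C + (ε : ℂ) • 1).IsHermitian :=
      (hCp.add_posSemidef (Matrix.PosSemidef.one.smul
        (by exact_mod_cast hε.le : (0 : ℂ) ≤ (ε : ℂ)))).isHermitian
    have h1 := concave_eps f hmono A B hAp hBp l hl ε hε hCε
    have h2 := hermApply_mul_diag f _ hCε W (fun i => hC.eigenvalues i + ε) (by
      rw [Matrix.add_mul, hCW, Matrix.smul_mul, Matrix.one_mul]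
      ext i j
      simp [Matrix.mul_diagonal]
      ring)
    have h3 : hermApply f _ hCε
        = W * Matrix.diagonal (fun i => (f (hC.eigenvalues i + ε) : ℂ)) * star W := by
      rw [← h2, Matrix.mul_assoc, hWW', Matrix.mul_one]
    have h4 : (Matrix.diagonal (fun i => ((g ε i - f (hC.eigenvalues i + ε) : ℝ) : ℂ))).PosSemidef := by
      rw [Matrix.posSemidef_diagonal_iff]
      intro i
      have := hg ε hε i (hi i)
      have h5 : 0 ≤ g ε i - f (hC.eigenvalues i + ε) := by linarith
      exact_mod_cast h5
    have h5 := (h4.mul_mul_conjTranspose_same W).add h1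
    convert h5 using 1
    rw [h3, ← Matrix.star_eq_conjTranspose]
    have h6 : Matrix.diagonal (fun i => ((g ε i - f (hC.eigenvalues i + ε) : ℝ) : ℂ))
        = Matrix.diagonal (fun i => (g ε i : ℂ))
          - Matrix.diagonal (fun i => (f (hC.eigenvalues i + ε) : ℂ)) := by
      rw [Matrix.diagonal_sub]; push_cast; rfl
    rw [h6, Matrix.mul_sub, Matrix.sub_mul, hR]
    abel
  have hev : ∀ᶠ ε in nhdsWithin (0 : ℝ) (Ioi 0),
      (W * Matrix.diagonal (fun i => (g ε i : ℂ)) * star W - R).PosSemidef := by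
    have h1 : ∀ᶠ ε in nhdsWithin (0 : ℝ) (Ioi 0), ∀ i, 4 * ε < hC.eigenvalues i := by
      rw [Filter.eventually_all]
      intro i
      apply Filter.Eventually.filter_mono nhdsWithin_le_nhds
      have : ContinuousAt (fun ε : ℝ => 4 * ε) 0 := by fun_prop
      exact this.eventually_lt continuousAt_const (by simpa using hce i)
    filter_upwards [h1, self_mem_nhdsWithin] with ε h2 h3
    exact hpsd ε h3 h2
  have hgt : ∀ i, Filter.Tendsto (fun ε => g ε i) (nhdsWithin (0 : ℝ) (Ioi 0))
      (nhds (f (hC.eigenvalues i))) := by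
    intro i
    have : ContinuousAt (fun ε => g ε i) 0 := by
      simp only [g]
      apply ContinuousAt.div
      · fun_prop
      · fun_prop
      · simp
    have h2 := this.tendsto
    simp only [g] at h2
    simp only [mul_zero, zero_div, zero_mul, sub_zero, div_one] at h2
    exact h2.mono_left nhdsWithin_le_nhds
  have hlim : Filter.Tendsto
      (fun ε => W * Matrix.diagonal (fun i => (g ε i : ℂ)) * star W - R)
      (nhdsWithin (0 : ℝ) (Ioi 0)) (nhds (hermApply f C hC - R)) := by
    have hd : Filter.Tendsto (fun ε => (fun i => (g ε i : ℂ))) (nhdsWithin (0 : ℝ) (Ioi 0))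
        (nhds (fun i => (f (hC.eigenvalues i) : ℂ))) := by
      rw [tendsto_pi_nhds]
      intro i
      exact (Complex.continuous_ofReal.tendsto _).comp (hgt i)
    have hcont : Continuous (fun d : Fin n → ℂ => W * Matrix.diagonal d * star W - R) := by
      fun_prop
    exact (hcont.tendsto _).comp hd
  have hherm : (hermApply f C hC - R).IsHermitian := by
    have hc : Continuous (fun M : Matrix (Fin n) (Fin n) ℂ => M.conjTranspose) := by fun_prop
    have := (hc.tendsto _).comp hlim
    refine tendsto_nhds_unique (this.congr' ?_) hlim
    filter_upwards [hev] with ε h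
    exact h.isHermitian.eq
  refine Matrix.PosSemidef.of_dotProduct_mulVec_nonneg hherm ?_
  intro x
  have hc : Continuous (fun M : Matrix (Fin n) (Fin n) ℂ => dotProduct (star x) (M.mulVec x)) := by
    fun_prop
  refine ge_of_tendsto ((hc.tendsto _).comp hlim) ?_
  filter_upwards [hev] with ε h
  exact h.dotProduct_mulVec_nonneg x
end

section
/- Let f : (a,b) → ℝ be continuously differentiable. Then f is operator monotone of order n if and only if for all t₁,…,t_n ∈ (a,b), the n×n matrix of first divided differences [Δf(t_i, t_j)]_{i,j=1}^n is positive semi-definite. -/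
open Set
open scoped ComplexOrder

/-- First divided difference. -/
noncomputable def dd (f : ℝ → ℝ) (s t : ℝ) : ℝ :=
  if s = t then deriv f s else (f t - f s) / (t - s)

/-- Second divided difference (values at repeated points taken as limits). -/
noncomputable def dd2 (f : ℝ → ℝ) (r s t : ℝ) : ℝ :=
  dd (fun u => dd f r u) s t


open Filter Topology Matrix

local notation "𝕄" n => Matrix (Fin n) (Fin n) ℂ

/-- `A V = V diag(μ)` for the eigenvector unitary. -/
lemma eig_eq {n : ℕ} {A : 𝕄 n} (hA : A.IsHermitian) :
    A * (hA.eigenvectorUnitary : 𝕄 n) =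
      (hA.eigenvectorUnitary : 𝕄 n) * Matrix.diagonal (fun i => (hA.eigenvalues i : ℂ)) := by
  have h := hA.spectral_theorem
  rw [Unitary.conjStarAlgAut_apply] at h
  have h2 : star (hA.eigenvectorUnitary : 𝕄 n) * (hA.eigenvectorUnitary : 𝕄 n) = 1 :=
    Unitary.coe_star_mul_self _
  have h3 := congrArg (fun X => X * (hA.eigenvectorUnitary : 𝕄 n)) h
  refine h3.trans ?_
  rw [mul_assoc, h2, mul_one]
  rfl

lemma herm_eig {n : ℕ} (f : ℝ → ℝ) {A : 𝕄 n} (hA : A.IsHermitian) :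
    hermApply f A hA * (hA.eigenvectorUnitary : 𝕄 n) =
      (hA.eigenvectorUnitary : 𝕄 n) * Matrix.diagonal (fun i => (f (hA.eigenvalues i) : ℂ)) := by
  have h2 : star (hA.eigenvectorUnitary : 𝕄 n) * (hA.eigenvectorUnitary : 𝕄 n) = 1 :=
    Unitary.coe_star_mul_self _
  rw [hermApply, mul_assoc, h2, mul_one]

/-- If `V, W` both diagonalize `A`, entries of `V* W` link the eigenvalues. -/
lemma overlap {n : ℕ} {A V W : 𝕄 n} {m l : Fin n → ℝ} (hA : A.IsHermitian)
    (hV : A * V = V * Matrix.diagonal (fun i => (m i : ℂ)))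
    (hW : A * W = W * Matrix.diagonal (fun i => (l i : ℂ))) (i j : Fin n)
    (h : (star V * W) i j ≠ 0) : m i = l j := by
  have h1 : star V * A = Matrix.diagonal (fun i => (m i : ℂ)) * star V := by
    have := congrArg star hV
    rw [star_mul, star_mul] at this
    rw [star_eq_conjTranspose A, hA.eq] at this
    rw [this, star_eq_conjTranspose (Matrix.diagonal _), diagonal_conjTranspose]
    congr 2
    ext i; simp
  have h2 : Matrix.diagonal (fun i => (m i : ℂ)) * (star V * W) =
      (star V * W) * Matrix.diagonal (fun i => (l i : ℂ)) := by
    rw [← mul_assoc, ← h1, mul_assoc, hW, mul_assoc]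
  have h3 := congrFun (congrFun h2 i) j
  rw [diagonal_mul, mul_diagonal, mul_comm] at h3
  exact_mod_cast mul_left_cancel₀ h h3

lemma herm_of_eig {n : ℕ} (f : ℝ → ℝ) {A W : 𝕄 n} {l : Fin n → ℝ} (hA : A.IsHermitian)
    (hW : A * W = W * Matrix.diagonal (fun i => (l i : ℂ))) :
    hermApply f A hA * W = W * Matrix.diagonal (fun i => (f (l i) : ℂ)) := by
  set V : 𝕄 n := (hA.eigenvectorUnitary : 𝕄 n) with hVdef
  have hVV : V * star V = 1 := Unitary.coe_mul_star_self _
  have key : Matrix.diagonal (fun i => (f (hA.eigenvalues i) : ℂ)) * (star V * W) =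
      (star V * W) * Matrix.diagonal (fun i => (f (l i) : ℂ)) := by
    ext i j
    rw [diagonal_mul, mul_diagonal]
    by_cases h : (star V * W) i j = 0
    · simp [h]
    · rw [overlap hA (eig_eq hA) hW i j h, mul_comm]
  calc hermApply f A hA * W = V * (Matrix.diagonal (fun i => (f (hA.eigenvalues i) : ℂ)) * (star V * W)) := by
        rw [hermApply]; simp only [mul_assoc, hVdef]
    _ = _ := by rw [key, ← mul_assoc, ← mul_assoc, hVV, one_mul]

lemma dd_mul (f : ℝ → ℝ) (s t : ℝ) : dd f s t * (t - s) = f t - f s := by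
  unfold dd
  split_ifs with h
  · simp [h]
  · field_simp [sub_ne_zero.2 (Ne.symm h)]

lemma dd_cont (f : ℝ → ℝ) (s t : ℝ) (hs : DifferentiableAt ℝ f s)
    (ht : DifferentiableAt ℝ f t) : ContinuousAt (dd f s) t := by
  have : dd f s = dslope f s := by
    ext u
    unfold dd
    split_ifs with h
    · subst h; simp
    · rw [dslope_of_ne _ (Ne.symm h), slope_def_field]
  rw [this]
  by_cases h : t = s
  · subst h; exact continuousAt_dslope_same.2 hs
  · exact (continuousAt_dslope_of_ne h).2 ht.continuousAt

/-- The exact two-point formula. -/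
lemma two_point {n : ℕ} (f : ℝ → ℝ) {A B U V : 𝕄 n} {l m : Fin n → ℝ}
    (hA : A.IsHermitian) (hB : B.IsHermitian)
    (hU : star U * U = 1) (hU' : U * star U = 1) (hV' : V * star V = 1)
    (hAU : A * U = U * Matrix.diagonal (fun i => (l i : ℂ)))
    (hBV : B * V = V * Matrix.diagonal (fun i => (m i : ℂ))) :
    hermApply f B hB - hermApply f A hA =
      U * (Matrix.of (fun i j => (dd f (l i) (m j) : ℂ)) ⊙ (star U * (B - A) * V)) * star V := by
  have hfA := herm_of_eig f hA hAU
  have hfB := herm_of_eig f hB hBV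
  have aux : ∀ (g : Fin n → ℝ) (X : 𝕄 n), X.IsHermitian →
      X * U = U * Matrix.diagonal (fun i => (g i : ℂ)) →
      star U * X = Matrix.diagonal (fun i => (g i : ℂ)) * star U := by
    intro g X hX h
    have := congrArg star h
    rw [star_mul, star_mul] at this
    rw [star_eq_conjTranspose X, hX.eq] at this
    rw [this, star_eq_conjTranspose (Matrix.diagonal _), diagonal_conjTranspose]
    congr 2
    ext i; simp
  have hfAh : (hermApply f A hA).IsHermitian := by
    unfold hermApply
    rw [star_eq_conjTranspose]
    apply isHermitian_mul_mul_conjTranspose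
    apply isHermitian_diagonal_of_self_adjoint
    ext i; simp
  have e1 : star U * (hermApply f B hB - hermApply f A hA) * V =
      Matrix.of (fun i j => (dd f (l i) (m j) : ℂ)) ⊙ (star U * (B - A) * V) := by
    rw [mul_sub, mul_sub, sub_mul, sub_mul, aux _ _ hfAh hfA, aux _ _ hA hAU, mul_assoc, hfB,
      mul_assoc (star U) B, hBV]
    ext i j
    simp only [← mul_assoc, Matrix.sub_apply, hadamard_apply, of_apply, mul_diagonal]
    rw [mul_assoc, mul_assoc (Matrix.diagonal _), diagonal_mul, diagonal_mul]
    have := dd_mul f (l i) (m j)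
    have h2 : (dd f (l i) (m j) : ℂ) * (m j - l i) = f (m j) - f (l i) := by exact_mod_cast this
    linear_combination (-(star U * V) i j) * h2
  rw [← e1]
  simp only [← mul_assoc, hU', one_mul]
  rw [mul_assoc, hV', mul_one]

lemma unitary_compact (n : ℕ) : IsCompact (Matrix.unitaryGroup (Fin n) ℂ : Set (𝕄 n)) := by
  have hc : IsCompact (Set.univ.pi fun _ : Fin n => Set.univ.pi fun _ : Fin n =>
      Metric.closedBall (0 : ℂ) 1) :=
    isCompact_univ_pi fun _ => isCompact_univ_pi fun _ => isCompact_closedBall 0 1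
  refine IsCompact.of_isClosed_subset (X := 𝕄 n) hc (isClosed_unitary (R := 𝕄 n)) ?_
  intro U hU
  refine Set.mem_univ_pi.2 fun i => Set.mem_univ_pi.2 fun j => ?_
  rw [Metric.mem_closedBall, dist_zero_right]
  exact entry_norm_bound_of_unitary hU i j

/-- Limits of eigen-decompositions along an ultrafilter. -/
lemma ultra_limit {n : ℕ} {M : ℝ → 𝕄 n} (hM : ∀ s, (M s).IsHermitian) {A : 𝕄 n}
    (F : Ultrafilter ℝ) (hF : Tendsto M F (𝓝 A)) :
    ∃ (V : 𝕄 n) (m : Fin n → ℝ), V ∈ Matrix.unitaryGroup (Fin n) ℂ ∧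
      Tendsto (fun s => ((hM s).eigenvectorUnitary : 𝕄 n)) F (𝓝 V) ∧
      (∀ i, Tendsto (fun s => (hM s).eigenvalues i) F (𝓝 (m i))) ∧
      A * V = V * Matrix.diagonal (fun i => (m i : ℂ)) := by
  have := (unitary_compact n).ultrafilter_le_nhds
    (F.map (fun s => ((hM s).eigenvectorUnitary : 𝕄 n)))
    (by
      rw [le_principal_iff]
      refine Ultrafilter.mem_map.2 (Filter.univ_mem' fun s => ?_)
      exact ((hM s).eigenvectorUnitary).2)
  obtain ⟨V, hV, hlim⟩ := this
  have hlim' : Tendsto (fun s => ((hM s).eigenvectorUnitary : 𝕄 n)) F (𝓝 V) := hlim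
  have hd : Tendsto (fun s => star ((hM s).eigenvectorUnitary : 𝕄 n) * M s *
      ((hM s).eigenvectorUnitary : 𝕄 n)) F (𝓝 (star V * A * V)) :=
    (hlim'.star.mul hF).mul hlim'
  have heq : ∀ s, star ((hM s).eigenvectorUnitary : 𝕄 n) * M s *
      ((hM s).eigenvectorUnitary : 𝕄 n) = Matrix.diagonal (fun i => ((hM s).eigenvalues i : ℂ)) := by
    intro s
    rw [mul_assoc, eig_eq, ← mul_assoc, Unitary.coe_star_mul_self, one_mul]
  simp only [heq] at hd
  have hent : ∀ i j, Tendsto (fun s => (Matrix.diagonal (fun i => ((hM s).eigenvalues i : ℂ)) : 𝕄 n) i j)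
      F (𝓝 ((star V * A * V) i j)) := fun i j =>
    ((continuous_id.matrix_elem i j).tendsto _).comp hd
  have hmi : ∀ i, Tendsto (fun s => (hM s).eigenvalues i) F (𝓝 ((star V * A * V) i i).re) := by
    intro i
    have := (Complex.continuous_re.tendsto _).comp (hent i i)
    simpa [Function.comp_def] using this
  refine ⟨V, fun i => ((star V * A * V) i i).re, hV, hlim', hmi, ?_⟩
  have hVV : V * star V = 1 := (Matrix.mem_unitaryGroup_iff).1 hV
  have : star V * A * V = Matrix.diagonal (fun i => (((star V * A * V) i i).re : ℂ)) := by
    ext i j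
    by_cases h : i = j
    · subst h
      rw [diagonal_apply_eq]
      refine tendsto_nhds_unique (hent i i) ?_
      simp only [diagonal_apply_eq]
      exact (Complex.continuous_ofReal.tendsto _).comp (hmi i)
    · have := hent i j
      simp only [diagonal_apply_ne _ h] at this ⊢
      exact tendsto_nhds_unique this tendsto_const_nhds
  rw [← this, ← mul_assoc, ← mul_assoc, hVV, one_mul]

lemma eig_mem {n : ℕ} {A U V : 𝕄 n} {l m : Fin n → ℝ} {S : Set ℝ} (hA : A.IsHermitian)
    (hU : U ∈ Matrix.unitaryGroup (Fin n) ℂ) (hV : V ∈ Matrix.unitaryGroup (Fin n) ℂ)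
    (hAU : A * U = U * Matrix.diagonal (fun i => (l i : ℂ)))
    (hAV : A * V = V * Matrix.diagonal (fun i => (m i : ℂ)))
    (hl : ∀ i, l i ∈ S) (j : Fin n) : m j ∈ S := by
  by_contra hcon
  have hz : ∀ k, (star V * U) j k = 0 := by
    intro k
    by_contra h
    exact hcon (overlap hA hAV hAU j k h ▸ hl k)
  have h1 : (star V * U) * (star U * V) = 1 := by
    rw [mul_assoc, ← mul_assoc U, (Matrix.mem_unitaryGroup_iff).1 hU, one_mul,
      (Matrix.mem_unitaryGroup_iff').1 hV]
  have h2 := congrFun (congrFun h1 j) j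
  rw [mul_apply] at h2
  simp [hz] at h2

/-- Eigenvalues stay in an open set for small perturbations. -/
lemma eig_eventually {n : ℕ} {M : ℝ → 𝕄 n} (hM : ∀ s, (M s).IsHermitian) {s₀ : ℝ}
    (hc : Tendsto M (𝓝 s₀) (𝓝 (M s₀))) {U : 𝕄 n} {l : Fin n → ℝ} {S : Set ℝ} (hS : IsOpen S)
    (hU : U ∈ Matrix.unitaryGroup (Fin n) ℂ)
    (hAU : M s₀ * U = U * Matrix.diagonal (fun i => (l i : ℂ))) (hl : ∀ i, l i ∈ S) :
    ∀ᶠ s in 𝓝 s₀, ∀ i, (hM s).eigenvalues i ∈ S := by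
  refine mem_iff_ultrafilter.2 fun F hF => ?_
  obtain ⟨V, m, hV, -, hm, hAV⟩ := ultra_limit hM F (hc.mono_left hF)
  change ∀ᶠ s in (F : Filter ℝ), ∀ i, (hM s).eigenvalues i ∈ S
  rw [eventually_all]
  intro i
  exact (hm i).eventually (hS.mem_nhds (eig_mem (hM s₀) hU hV hAU hAV hl i))

/-- Daleckii-Krein formula. -/
lemma daleckii_krein {n : ℕ} (f : ℝ → ℝ) {M : ℝ → 𝕄 n} (hM : ∀ s, (M s).IsHermitian) {s₀ : ℝ}
    {H : 𝕄 n} (hH : ∀ s, M s - M s₀ = (s - s₀) • H) {U : 𝕄 n} {l : Fin n → ℝ}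
    (hU : U ∈ Matrix.unitaryGroup (Fin n) ℂ)
    (hAU : M s₀ * U = U * Matrix.diagonal (fun i => (l i : ℂ)))
    (hl : ∀ i, DifferentiableAt ℝ f (l i)) :
    Tendsto (fun s => (s - s₀)⁻¹ • (hermApply f (M s) (hM s) - hermApply f (M s₀) (hM s₀)))
      (𝓝[≠] s₀)
      (𝓝 (U * (Matrix.of (fun i j => (dd f (l i) (l j) : ℂ)) ⊙ (star U * H * U)) * star U)) := by
  have hc : Tendsto M (𝓝 s₀) (𝓝 (M s₀)) := by
    have h1 : M = fun s => M s₀ + (s - s₀) • H := by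
      ext1 s; rw [← hH]; abel
    have h2 : Continuous M := by rw [h1]; fun_prop
    exact h2.tendsto _
  have hUU : star U * U = 1 := (Matrix.mem_unitaryGroup_iff').1 hU
  have hUU' : U * star U = 1 := (Matrix.mem_unitaryGroup_iff).1 hU
  rw [tendsto_iff_ultrafilter]
  intro F hF
  have hF0 : (F : Filter ℝ) ≤ 𝓝 s₀ := hF.trans nhdsWithin_le_nhds
  obtain ⟨V, m, hV, hVlim, hm, hAV⟩ := ultra_limit hM F (hc.mono_left hF0)
  have hVV' : V * star V = 1 := (Matrix.mem_unitaryGroup_iff).1 hV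
  have hmd : ∀ j, DifferentiableAt ℝ f (m j) := fun j =>
    eig_mem (S := {x | DifferentiableAt ℝ f x}) (hM s₀) hU hV hAU hAV hl j
  have hne : ∀ᶠ s in (F : Filter ℝ), s ≠ s₀ := hF self_mem_nhdsWithin
  have hform : ∀ᶠ s in (F : Filter ℝ),
      U * (Matrix.of (fun i j => (dd f (l i) ((hM s).eigenvalues j) : ℂ)) ⊙
        (star U * H * ((hM s).eigenvectorUnitary : 𝕄 n))) *
          star ((hM s).eigenvectorUnitary : 𝕄 n) =
      (s - s₀)⁻¹ • (hermApply f (M s) (hM s) - hermApply f (M s₀) (hM s₀)) := by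
    filter_upwards [hne] with s hs
    rw [two_point f (hM s₀) (hM s) hUU hUU' (Unitary.coe_mul_star_self _) hAU (eig_eq (hM s)),
      hH]
    have h0 : s - s₀ ≠ 0 := sub_ne_zero.2 hs
    simp only [Matrix.mul_smul, Matrix.smul_mul, hadamard_smul, smul_smul, inv_mul_cancel₀ h0,
      one_smul]
  refine Tendsto.congr' hform ?_
  have hD : Tendsto (fun s => (Matrix.of (fun i j => (dd f (l i) ((hM s).eigenvalues j) : ℂ)) ⊙
        (star U * H * ((hM s).eigenvectorUnitary : 𝕄 n)))) F
      (𝓝 (Matrix.of (fun i j => (dd f (l i) (m j) : ℂ)) ⊙ (star U * H * V))) := by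
    have hX : Tendsto (fun s => star U * H * ((hM s).eigenvectorUnitary : 𝕄 n)) F
      (𝓝 (star U * H * V)) := tendsto_const_nhds.mul hVlim
    refine tendsto_pi_nhds.2 fun i => tendsto_pi_nhds.2 fun j => ?_
    simp only [hadamard_apply, of_apply]
    refine Tendsto.mul ?_ (((continuous_id.matrix_elem i j).tendsto _).comp hX)
    exact (Complex.continuous_ofReal.tendsto _).comp
      ((dd_cont f (l i) (m j) (hl i) (hmd j)).tendsto.comp (hm j))
  have hfin := (tendsto_const_nhds (x := U) (f := (F : Filter ℝ))).mul hD |>.mul hVlim.star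
  convert hfin using 2
  have key : (Matrix.of (fun i j => (dd f (l i) (l j) : ℂ)) ⊙ (star U * H * U)) =
      (Matrix.of (fun i j => (dd f (l i) (m j) : ℂ)) ⊙ (star U * H * V)) * (star V * U) := by
    ext i k
    have e : star U * H * U = (star U * H * V) * (star V * U) := by
      rw [mul_assoc _ V, ← mul_assoc V, hVV', one_mul]
    rw [hadamard_apply, e, mul_apply, mul_apply, Finset.mul_sum]
    refine Finset.sum_congr rfl fun j _ => ?_
    rw [hadamard_apply, of_apply, of_apply]
    by_cases h : (star V * U) j k = 0
    · simp [h]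
    · rw [overlap (hM s₀) hAV hAU j k h]; ring
  rw [key, mul_assoc, mul_assoc, mul_assoc (star V), hUU', mul_one, ← mul_assoc]

lemma posDef_iff_gt {n : ℕ} {A : 𝕄 n} (hA : A.IsHermitian) (a : ℝ) :
    (A - (a : ℂ) • (1 : 𝕄 n)).PosDef ↔ ∀ i, a < hA.eigenvalues i := by
  set V : 𝕄 n := (hA.eigenvectorUnitary : 𝕄 n)
  have hVV : star V * V = 1 := Unitary.coe_star_mul_self _
  have hu : IsUnit V := IsUnit.of_mul_eq_one_right _ hVV
  rw [← Matrix.IsUnit.posDef_star_left_conjugate_iff hu]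
  have : star V * (A - (a : ℂ) • (1 : 𝕄 n)) * V =
      Matrix.diagonal (fun i => ((hA.eigenvalues i - a : ℝ) : ℂ)) := by
    rw [mul_sub, sub_mul, mul_assoc, eig_eq hA, ← mul_assoc, hVV]
    simp only [Matrix.mul_smul, Matrix.smul_mul, mul_one, hVV, one_mul]
    rw [smul_one_eq_diagonal, diagonal_sub]
    congr 1; ext i; simp
  rw [this, posDef_diagonal_iff]
  simp only [Complex.zero_lt_real, sub_pos]

lemma posDef_iff_lt {n : ℕ} {A : 𝕄 n} (hA : A.IsHermitian) (b : ℝ) :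
    ((b : ℂ) • (1 : 𝕄 n) - A).PosDef ↔ ∀ i, hA.eigenvalues i < b := by
  set V : 𝕄 n := (hA.eigenvectorUnitary : 𝕄 n)
  have hVV : star V * V = 1 := Unitary.coe_star_mul_self _
  have hu : IsUnit V := IsUnit.of_mul_eq_one_right _ hVV
  rw [← Matrix.IsUnit.posDef_star_left_conjugate_iff hu]
  have : star V * ((b : ℂ) • (1 : 𝕄 n) - A) * V =
      Matrix.diagonal (fun i => ((b - hA.eigenvalues i : ℝ) : ℂ)) := by
    rw [mul_sub, sub_mul, mul_assoc _ A, eig_eq hA, ← mul_assoc _ _ (Matrix.diagonal _), hVV]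
    simp only [Matrix.mul_smul, Matrix.smul_mul, mul_one, hVV, one_mul]
    rw [smul_one_eq_diagonal, diagonal_sub]
    congr 1; ext i; simp
  rw [this, posDef_diagonal_iff]
  simp only [Complex.zero_lt_real, sub_pos]

lemma posDef_convex {n : ℕ} {P Q : 𝕄 n} (hP : P.PosDef) (hQ : Q.PosDef) {s : ℝ}
    (h0 : 0 ≤ s) (h1 : s ≤ 1) : ((1 - s) • P + s • Q).PosDef := by
  rcases h0.eq_or_lt with rfl | h0
  · simpa using hP
  · have h3 : (s • Q).PosDef := by
      have := hQ.smul (α := ℝ) h0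
      exact this
    have h4 : ((1 - s) • P).PosSemidef := hP.posSemidef.smul (α := ℝ) (sub_nonneg.2 h1)
    exact h3.posSemidef_add h4

lemma real_to_complex {n : ℕ} {L : Matrix (Fin n) (Fin n) ℝ} (h : L.PosSemidef) :
    (Matrix.of fun i j => (L i j : ℂ)).PosSemidef := by
  obtain ⟨C, rfl⟩ : ∃ C : Matrix (Fin n) (Fin n) ℝ, L = Cᴴ * C := by
    open scoped MatrixOrder in
    exact CStarAlgebra.nonneg_iff_eq_star_mul_self.mp h.nonneg
  convert Matrix.posSemidef_conjTranspose_mul_self (C.map (fun x => (x : ℂ))) using 1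
  ext i j
  simp [mul_apply]

lemma complex_to_real {n : ℕ} {L : Matrix (Fin n) (Fin n) ℝ}
    (h : (Matrix.of fun i j => (L i j : ℂ)).PosSemidef) : L.PosSemidef := by
  refine .of_dotProduct_mulVec_nonneg ?_ fun x => ?_
  · ext i j
    have := congrFun (congrFun h.1 i) j
    simp at this
    simpa using this
  · have := h.dotProduct_mulVec_nonneg (fun i => (x i : ℂ))
    simp only [dotProduct, mulVec, Pi.star_apply, of_apply, Complex.star_def, Complex.conj_ofReal] at this
    simp only [dotProduct, mulVec, Pi.star_apply, star_trivial]
    exact_mod_cast this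

lemma posSemidef_closed {n : ℕ} : IsClosed {X : 𝕄 n | X.PosSemidef} := by
  simp only [posSemidef_iff_dotProduct_mulVec, Set.ofPred_and, Set.ofPred_forall, IsHermitian]
  refine IsClosed.inter (isClosed_eq (by fun_prop) (by fun_prop)) (isClosed_iInter fun x => ?_)
  refine isClosed_le continuous_const ?_
  fun_prop

theorem matrixMonotone_iff_ddMatrix_posSemidef {n : ℕ} (a b : ℝ) (f : ℝ → ℝ)
    (hf : ContDiffOn ℝ 1 f (Ioo a b)) :
    (∀ (A B : Matrix (Fin n) (Fin n) ℂ) (hA : A.IsHermitian) (hB : B.IsHermitian),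
      (∀ i, hA.eigenvalues i ∈ Ioo a b) → (∀ i, hB.eigenvalues i ∈ Ioo a b) →
      (B - A).PosSemidef → (hermApply f B hB - hermApply f A hA).PosSemidef)
    ↔ ∀ t : Fin n → ℝ, (∀ i, t i ∈ Ioo a b) →
        (Matrix.of fun i j => dd f (t i) (t j)).PosSemidef := by
  have hd : ∀ x ∈ Ioo a b, DifferentiableAt ℝ f x := fun x hx =>
    (hf.differentiableOn one_ne_zero).differentiableAt (Ioo_mem_nhds hx.1 hx.2)
  constructor
  · intro hmono t ht
    have hJ : (Matrix.of fun _ _ => 1 : 𝕄 n).PosSemidef := by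
      convert posSemidef_vecMulVec_self_star (fun _ : Fin n => (1 : ℂ)) using 1
      ext i j; simp [vecMulVec]
    set J : 𝕄 n := Matrix.of fun _ _ => 1 with hJdef
    set M : ℝ → 𝕄 n := fun s => Matrix.diagonal (fun i => (t i : ℂ)) + s • J with hMdef
    have hM : ∀ s, (M s).IsHermitian := by
      intro s
      refine IsHermitian.add (isHermitian_diagonal_of_self_adjoint _ (by ext i; simp)) ?_
      ext i j; simp [J]
    have hAU : M 0 * 1 = 1 * Matrix.diagonal (fun i => (t i : ℂ)) := by simp [M]
    have hU : (1 : 𝕄 n) ∈ Matrix.unitaryGroup (Fin n) ℂ := one_mem _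
    have hH : ∀ s, M s - M 0 = (s - 0) • J := by intro s; simp [M]
    have hlim := daleckii_krein f hM hH hU hAU (fun i => hd _ (ht i))
    have hc : Tendsto M (𝓝 0) (𝓝 (M 0)) := by
      have : Continuous M := by fun_prop
      exact this.tendsto _
    have hev := eig_eventually hM hc isOpen_Ioo hU hAU ht
    have hev0 := hev.self_of_nhds
    have hlim' := hlim.mono_left (nhdsWithin_mono 0 (fun x (hx : 0 < x) => hx.ne') :
      𝓝[>] (0:ℝ) ≤ 𝓝[≠] 0)
    have hps := posSemidef_closed.mem_of_tendsto hlim' (by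
      filter_upwards [hev.filter_mono nhdsWithin_le_nhds, self_mem_nhdsWithin] with s hs hs0
      have hs0 : 0 < s := hs0
      have h1 := hmono (M 0) (M s) (hM 0) (hM s) hev0 hs (by
        rw [hH s, sub_zero]; exact hJ.smul (α := ℝ) hs0.le)
      exact h1.smul (α := ℝ) (by rw [sub_zero]; exact (inv_pos.2 hs0).le))
    apply complex_to_real
    have hps' : Matrix.PosSemidef _ := hps
    convert hps' using 1
    ext i j; simp [J]
  · intro hL A B hA hB hAs hBs hAB
    set H : 𝕄 n := B - A with hHdef
    set M : ℝ → 𝕄 n := fun s => A + s • H with hMdef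
    have hM : ∀ s, (M s).IsHermitian := by
      intro s
      refine hA.add ?_
      have h : (s • H)ᴴ = s • H := by rw [conjTranspose_smul, hAB.1.eq]; simp
      exact h
    have hH : ∀ s₀ s, M s - M s₀ = (s - s₀) • H := by
      intro s₀ s; simp only [M, sub_smul]; abel
    have hspec : ∀ s ∈ Icc (0:ℝ) 1, ∀ i, (hM s).eigenvalues i ∈ Ioo a b := by
      intro s hs i
      refine ⟨(posDef_iff_gt (hM s) a).1 ?_ i, (posDef_iff_lt (hM s) b).1 ?_ i⟩
      · convert posDef_convex ((posDef_iff_gt hA a).2 fun i => (hAs i).1)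
          ((posDef_iff_gt hB a).2 fun i => (hBs i).1) hs.1 hs.2 using 1
        simp only [M, H]; module
      · convert posDef_convex ((posDef_iff_lt hA b).2 fun i => (hAs i).2)
          ((posDef_iff_lt hB b).2 fun i => (hBs i).2) hs.1 hs.2 using 1
        simp only [M, H]; module
    have hM0 : M 0 = A := by simp [M]
    have hM1 : M 1 = B := by simp [M, H]
    have hcongr : ∀ (X Y : 𝕄 n) (hX : X.IsHermitian) (hY : Y.IsHermitian), X = Y →
        hermApply f X hX = hermApply f Y hY := by
      rintro X Y hX hY rfl; rfl
    rw [← hcongr _ _ (hM 0) hA hM0, ← hcongr _ _ (hM 1) hB hM1]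
    have hherm : ∀ s, (hermApply f (M s) (hM s)).IsHermitian := by
      intro s
      unfold hermApply
      rw [star_eq_conjTranspose]
      apply isHermitian_mul_mul_conjTranspose
      apply isHermitian_diagonal_of_self_adjoint
      ext i; simp
    have hsub := (hherm 1).sub (hherm 0)
    refine .of_dotProduct_mulVec_nonneg hsub fun x => ?_
    set φ : (𝕄 n) →ₗ[ℝ] ℝ :=
      { toFun := fun X => (star x ⬝ᵥ (X *ᵥ x)).re
        map_add' := by intro X Y; simp [add_mulVec, dotProduct_add]
        map_smul' := by intro c X; simp [smul_mulVec, dotProduct_smul] } with hφ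
    have hφc : Continuous φ := by
      change Continuous fun X : 𝕄 n => (star x ⬝ᵥ (X *ᵥ x)).re
      fun_prop
    set g : ℝ → ℝ := fun s => φ (hermApply f (M s) (hM s)) with hg
    have hder : ∀ s ∈ Icc (0:ℝ) 1, ∃ d, 0 ≤ d ∧ HasDerivAt g d s := by
      intro s hs
      have hlim := daleckii_krein f hM (hH s) ((hM s).eigenvectorUnitary).2 (eig_eq (hM s))
        (fun i => hd _ (hspec s hs i))
      refine ⟨φ ((((hM s).eigenvectorUnitary : 𝕄 n)) * (Matrix.of (fun i j =>
          (dd f ((hM s).eigenvalues i) ((hM s).eigenvalues j) : ℂ)) ⊙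
          (star ((hM s).eigenvectorUnitary : 𝕄 n) * H * ((hM s).eigenvectorUnitary : 𝕄 n))) *
          star ((hM s).eigenvectorUnitary : 𝕄 n)), ?_, ?_⟩
      · have h1 := real_to_complex (hL _ (hspec s hs))
        have h2 := hAB.conjTranspose_mul_mul_same ((hM s).eigenvectorUnitary : 𝕄 n)
        have h3 := (h1.hadamard h2).mul_mul_conjTranspose_same ((hM s).eigenvectorUnitary : 𝕄 n)
        exact h3.re_dotProduct_nonneg x
      · rw [hasDerivAt_iff_tendsto_slope]
        refine ((hφc.tendsto _).comp hlim).congr fun y => ?_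
        simp only [Function.comp, map_smul, map_sub, slope, g, vsub_eq_sub]
    have hmonog : MonotoneOn g (Icc 0 1) := by
      refine monotoneOn_of_deriv_nonneg (convex_Icc 0 1) ?_ ?_ ?_
      · intro s hs
        obtain ⟨d, -, h⟩ := hder s hs
        exact h.continuousAt.continuousWithinAt
      · intro s hs
        obtain ⟨d, -, h⟩ := hder s (interior_subset hs)
        exact h.differentiableAt.differentiableWithinAt
      · intro s hs
        obtain ⟨d, h0, h⟩ := hder s (interior_subset hs)
        rw [h.deriv]; exact h0
    have h01 : g 0 ≤ g 1 := hmonog (by simp) (by simp) zero_le_one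
    have h5 : 0 ≤ φ (hermApply f (M 1) (hM 1) - hermApply f (M 0) (hM 0)) := by
      rw [map_sub]; exact sub_nonneg.2 h01
    rw [Complex.le_def]
    refine ⟨h5, ?_⟩
    exact (hsub.im_star_dotProduct_mulVec_self x).symm
end

section
/- If f : ℝ⁺ → ℝ⁺ is operator monotone, then the function t ↦ −f(t)/t is operator monotone on ℝ⁺; equivalently, t ↦ t/f(t) and t ↦ t·f(1/t) are operator monotone on ℝ⁺. -/
open Set

/-- `g` is operator monotone on the positive half-line: for positive invertible
self-adjoint operators on any complex Hilbert space, `A ≤ B` implies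
`g(A) ≤ g(B)` (via the continuous functional calculus). -/
def OperatorMonotonePos (g : ℝ → ℝ) : Prop :=
  ∀ (H : Type) [NormedAddCommGroup H] [InnerProductSpace ℂ H] [CompleteSpace H],
    ∀ A B : H →L[ℂ] H, IsSelfAdjoint A → IsSelfAdjoint B →
      spectrum ℝ A ⊆ Set.Ioi 0 → spectrum ℝ B ⊆ Set.Ioi 0 →
      A ≤ B → cfc g A ≤ cfc g B

section
variable {H E : Type} [NormedAddCommGroup H] [InnerProductSpace ℂ H] [CompleteSpace H]
   [NormedAddCommGroup E] [InnerProductSpace ℂ E] [CompleteSpace E]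

lemma intertwine (f : ℝ → ℝ) (A : H →L[ℂ] H) (B : E →L[ℂ] E) (W : H →L[ℂ] E)
    (hA : IsSelfAdjoint A) (hB : IsSelfAdjoint B) 
    (hf : ContinuousOn f (spectrum ℝ A ∪ spectrum ℝ B)) (h : B ∘L W = W ∘L A) :
    cfc f B ∘L W = W ∘L cfc f A := by
  set s := spectrum ℝ A ∪ spectrum ℝ B with hs
  have h1 : spectrum ℝ A ⊆ s := subset_union_left
  have h2 : spectrum ℝ B ⊆ s := subset_union_right
  have hcs : IsCompact s := (ContinuousFunctionalCalculus.isCompact_spectrum A).union (ContinuousFunctionalCalculus.isCompact_spectrum B)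
  have : CompactSpace s := isCompact_iff_compactSpace.mp hcs
  have key : ∀ g : C(s, ℝ), cfcHomSuperset hB h2 g ∘L W = W ∘L cfcHomSuperset hA h1 g := by
    intro g
    induction g using ContinuousMap.induction_on_of_compact with
    | const r =>
      have e : ContinuousMap.const s r = algebraMap ℝ C(s, ℝ) r := rfl
      rw [e, AlgHomClass.commutes, AlgHomClass.commutes]
      ext x; simp [Algebra.algebraMap_eq_smul_one]
    | id => rw [cfcHomSuperset_id, cfcHomSuperset_id]; exact h
    | star_id => rw [map_star, map_star, cfcHomSuperset_id, cfcHomSuperset_id, hA.star_eq, hB.star_eq]; exact h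
    | add f g hf hg => simp only [map_add, ContinuousLinearMap.add_comp, ContinuousLinearMap.comp_add, hf, hg]
    | mul f g hf hg =>
      simp only [map_mul, ContinuousLinearMap.mul_def]
      rw [ContinuousLinearMap.comp_assoc, hg, ← ContinuousLinearMap.comp_assoc, hf, ContinuousLinearMap.comp_assoc]
    | frequently f h =>
      refine h.mem_of_closed <| isClosed_eq ?_ ?_
      · have := cfcHomSuperset_continuous hB h2
        fun_prop
      · have := cfcHomSuperset_continuous hA h1
        fun_prop
  have := key ⟨s.domRestrict f, hf.domRestrict⟩
  rw [cfcHomSuperset_apply, cfcHomSuperset_apply] at this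
  rw [cfc_apply f A hA (hf.mono h1), cfc_apply f B hB (hf.mono h2)]
  exact this

set_option linter.unusedSectionVars false in
lemma fin_spec [FiniteDimensional ℂ E] (T : E →L[ℂ] E) : (spectrum ℝ T).Finite := by
  have h : (spectrum ℂ T).Finite := by
    rw [← AlgEquiv.spectrum_eq (Module.End.toContinuousLinearMap (𝕜 := ℂ) E).symm T]
    exact Module.End.finite_spectrum _
  rw [← spectrum.preimage_algebraMap ℂ]
  exact h.preimage (FaithfulSMul.algebraMap_injective ℝ ℂ).injOn


lemma spec_iff (T : E →L[ℂ] E) : (IsSelfAdjoint T ∧ spectrum ℝ T ⊆ Ioi 0) ↔ IsStrictlyPositive T := by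
  constructor
  · rintro ⟨h1, h2⟩
    exact (StarOrderedRing.isStrictlyPositive_iff_spectrum_pos (R := ℝ) T h1).2 (fun x hx => h2 hx)
  · intro h
    exact ⟨h.isSelfAdjoint, (StarOrderedRing.isStrictlyPositive_iff_spectrum_pos (R := ℝ) T h.isSelfAdjoint).1 h⟩

lemma spec_lb (T : E →L[ℂ] E) (hT : IsStrictlyPositive T) :
    ∃ η : ℝ, 0 < η ∧ η • (1 : E →L[ℂ] E) ≤ T := by
  have h := (spec_iff T).2 hT
  rcases subsingleton_or_nontrivial (E →L[ℂ] E) with hs | hs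
  · exact ⟨1, one_pos, (Subsingleton.elim _ _).le⟩
  obtain ⟨r, hr, h⟩ := (CFC.exists_pos_algebraMap_le_iff (A := E →L[ℂ] E) h.1).2 (fun x hx => h.2 hx)
  exact ⟨r, hr, by rwa [Algebra.algebraMap_eq_smul_one] at h⟩

lemma sp_smul_one {η : ℝ} (hη : 0 < η) : IsStrictlyPositive (η • (1 : E →L[ℂ] E)) := by
  have : IsStrictlyPositive (1 : E →L[ℂ] E) := ⟨zero_le_one, isUnit_one⟩
  exact this.smul hη

lemma inv_anti (A B : H →L[ℂ] H) (hA : IsStrictlyPositive A) (hAB : A ≤ B) :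
    cfc (fun t : ℝ => t⁻¹) B ≤ cfc (fun t : ℝ => t⁻¹) A := by
  have hB := hA.of_le hAB
  have := CStarAlgebra.ringInverse_le_ringInverse hAB hA
  rwa [← cfc_ringInverse_id (R := ℝ) B hB.isUnit hB.isSelfAdjoint, ← cfc_ringInverse_id (R := ℝ) A hA.isUnit hA.isSelfAdjoint] at this

lemma conj_le (V : H →L[ℂ] E) {X Y : H →L[ℂ] H} (h : X ≤ Y) :
    V ∘L X ∘L V.adjoint ≤ V ∘L Y ∘L V.adjoint := by
  rw [ContinuousLinearMap.le_def] at h ⊢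
  have := h.conj_adjoint V
  simpa only [ContinuousLinearMap.sub_comp, ContinuousLinearMap.comp_sub] using this

lemma dom (V : H →L[ℂ] E) (hV : V.adjoint ∘L V = 1) (T : E →L[ℂ] E) (hT : 0 ≤ T) (δ : ℝ) (hδ : 0 < δ)
    (X : H →L[ℂ] H) (hX : (1 + δ) • (V.adjoint ∘L T ∘L V) ≤ X) :
    T ≤ V ∘L X ∘L V.adjoint + ((1 + δ⁻¹) * ‖T‖) • (1 - V ∘L V.adjoint) := by
  set P : E →L[ℂ] E := V ∘L V.adjoint with hP
  have hPP : P * P = P := by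
    ext x
    have h : ∀ y, V.adjoint (V y) = y := fun y => by
      have := congrArg (fun L => L y) hV
      simpa using this
    simp [hP, h]
  have hPs : IsSelfAdjoint P := by
    rw [ContinuousLinearMap.isSelfAdjoint_iff', hP, ContinuousLinearMap.adjoint_comp,
      ContinuousLinearMap.adjoint_adjoint]
  have hQs : IsSelfAdjoint (1 - P) := (IsSelfAdjoint.one _).sub hPs
  have h1 : (1 + δ) • (P * T * P) ≤ V ∘L X ∘L V.adjoint := by
    have := conj_le V hX
    convert this using 1
    ext x; simp [hP]
  have h2 : (1 - P) * T * (1 - P) ≤ ‖T‖ • (1 - P) := by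
    have := hQs.conjugate_le_conjugate (IsSelfAdjoint.of_nonneg hT).le_algebraMap_norm_self
    refine this.trans_eq ?_
    rw [Algebra.algebraMap_eq_smul_one]
    simp only [mul_smul_comm, smul_mul_assoc, mul_one, mul_sub, sub_mul, one_mul, hPP, sub_self, sub_zero, smul_zero]
  have h3 : (1 + δ⁻¹) • ((1 - P) * T * (1 - P)) ≤ ((1 + δ⁻¹) * ‖T‖) • (1 - P) := by
    rw [mul_smul]
    exact smul_le_smul_of_nonneg_left h2 (by positivity)
  have h4 : 0 ≤ δ⁻¹ • ((δ • P - (1 - P)) * T * (δ • P - (1 - P))) := by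
    have hs : IsSelfAdjoint (δ • P - (1 - P)) := (IsSelfAdjoint.smul (by simp [isSelfAdjoint_iff]) hPs).sub hQs
    exact smul_nonneg (by positivity) (hs.conjugate_nonneg hT)
  have h5 : δ⁻¹ • ((δ • P - (1 - P)) * T * (δ • P - (1 - P))) =
      (1 + δ) • (P * T * P) + (1 + δ⁻¹) • ((1 - P) * T * (1 - P)) - T := by
    simp only [mul_smul_comm, smul_mul_assoc, mul_one, mul_sub, sub_mul, one_mul, smul_sub, smul_smul]
    match_scalars <;> field_simp <;> ring
  rw [h5, sub_nonneg] at h4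
  exact h4.trans (add_le_add h1 h3)

lemma exists_emb : ∃ i j : H →L[ℂ] WithLp 2 (H × H), (∀ x, i.adjoint (i x) = x) ∧ (∀ x, j.adjoint (j x) = x) ∧
   (∀ x, i.adjoint (j x) = 0) ∧ (∀ x, j.adjoint (i x) = 0) ∧ ∀ y, i (i.adjoint y) + j (j.adjoint y) = y := by
  let i : H →L[ℂ] WithLp 2 (H × H) := (WithLp.prodContinuousLinearEquiv 2 ℂ H H).symm.toContinuousLinearMap ∘L ContinuousLinearMap.inl ℂ H H
  let j : H →L[ℂ] WithLp 2 (H × H) := (WithLp.prodContinuousLinearEquiv 2 ℂ H H).symm.toContinuousLinearMap ∘L ContinuousLinearMap.inr ℂ H H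
  have hi : ∀ y, i.adjoint y = y.fst := fun y => by
    refine ext_inner_left ℂ fun x => ?_
    rw [ContinuousLinearMap.adjoint_inner_right]
    simp [i]
  have hj : ∀ y, j.adjoint y = y.snd := fun y => by
    refine ext_inner_left ℂ fun x => ?_
    rw [ContinuousLinearMap.adjoint_inner_right]
    simp [j]
  refine ⟨i, j, ?_, ?_, ?_, ?_, ?_⟩ <;> intro x <;> simp only [hi, hj] <;> simp [i, j]
  rw [← WithLp.toLp_add]; simp; rfl
set_option maxHeartbeats 1000000 in
lemma hansen (f : ℝ → ℝ) (hpos : ∀ x ∈ Ioi (0:ℝ), 0 < f x) (hf : OperatorMonotonePos f)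
    (hcH : ∀ Y : H →L[ℂ] H, IsStrictlyPositive Y → ContinuousOn f (spectrum ℝ Y))
    (i j : H →L[ℂ] E) (hii : ∀ x, i.adjoint (i x) = x) (hjj : ∀ x, j.adjoint (j x) = x)
    (hij : ∀ x, i.adjoint (j x) = 0) (hji : ∀ x, j.adjoint (i x) = 0)
    (hsum : ∀ y, i (i.adjoint y) + j (j.adjoint y) = y)
    (hcE : ∀ Y : E →L[ℂ] E, IsStrictlyPositive Y → ContinuousOn f (spectrum ℝ Y))
    (B X K : H →L[ℂ] H) (hB : IsStrictlyPositive B) (hX : IsStrictlyPositive X)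
    (t : ℝ) (ht1 : t < 1) (hK : star K * B * K = t • X) (hK1 : star K * K ≤ 1) :
    star K * cfc f B * K ≤ cfc f X := by
  obtain ⟨η, hη, hηX⟩ := spec_lb X hX
  obtain ⟨b, hb, hbB⟩ := spec_lb B hB
  have hM : 0 ≤ 1 - star K * K := sub_nonneg.2 hK1
  obtain ⟨D, hD⟩ : ∃ D : H →L[ℂ] H, star D * D = 1 - star K * K := by
    refine ⟨CFC.sqrt (1 - star K * K), ?_⟩
    rw [(IsSelfAdjoint.of_nonneg (CFC.sqrt_nonneg _)).star_eq]
    exact CFC.sqrt_mul_sqrt_self _ hM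
  have hDx : ∀ x, D.adjoint (D x) = x - K.adjoint (K x) := fun x => by
    have := congrArg (fun L => L x) hD
    simpa [ContinuousLinearMap.star_eq_adjoint] using this
  set ε : ℝ := (1 - t) * η / 4 with hε
  have hε0 : 0 < ε := by have := sub_pos.2 ht1; positivity
  set T : E →L[ℂ] E := i ∘L B ∘L i.adjoint + ε • (j ∘L j.adjoint) with hT
  set V : H →L[ℂ] E := i ∘L K + j ∘L D with hV
  have hVa : V.adjoint = K.adjoint ∘L i.adjoint + D.adjoint ∘L j.adjoint := by
    rw [hV, map_add, ContinuousLinearMap.adjoint_comp, ContinuousLinearMap.adjoint_comp]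
  have hVV : V.adjoint ∘L V = 1 := by
    ext x; rw [hVa]; simp [hV, hii, hjj, hij, hji, hDx]
  have hTi : T ∘L i = i ∘L B := by
    ext1 x; simp [hT, hii, hji]
  have hTj : T ∘L j = j ∘L (ε • (1 : H →L[ℂ] H)) := by
    ext1 x; simp [hT, hij, hjj]
  have hcomp : ∀ (T' : E →L[ℂ] E) (B' : H →L[ℂ] H) (e : ℝ),
      T' ∘L i = i ∘L B' → T' ∘L j = j ∘L (e • (1 : H →L[ℂ] H)) →
      V.adjoint ∘L T' ∘L V = star K * B' * K + e • (1 - star K * K) := by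
    intro T' B' e h1 h2
    have h1' : ∀ x, T' (i x) = i (B' x) := fun x => by simpa using congrArg (fun L => L x) h1
    have h2' : ∀ x, T' (j x) = e • (j x) := fun x => by simpa using congrArg (fun L => L x) h2
    ext x
    rw [hVa]
    simp [hV, h1', h2', hii, hjj, hij, hji, hDx, ContinuousLinearMap.star_eq_adjoint]
  have hTpos : IsStrictlyPositive T := by
    have h0 : 0 < min b ε := lt_min hb hε0
    refine (sp_smul_one h0).of_le ?_
    have e : min b ε • (1 : E →L[ℂ] E) =
        i ∘L (min b ε • (1 : H →L[ℂ] H)) ∘L i.adjoint + min b ε • (j ∘L j.adjoint) := by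
      ext1 y
      have := hsum y
      simp [← smul_add, this]
    rw [e, hT]
    have hone : (0 : H →L[ℂ] H) ≤ 1 := zero_le_one
    refine add_le_add (conj_le i (le_trans ?_ hbB)) ?_
    · exact smul_le_smul_of_nonneg_right (min_le_left _ _) hone
    · refine smul_le_smul_of_nonneg_right (min_le_right _ _) ?_
      have := conj_le j hone
      simpa [ContinuousLinearMap.one_def] using this
  set δ : ℝ := (1 - t) / 2 with hδ
  have hδ0 : 0 < δ := by have := sub_pos.2 ht1; positivity
  have hVTV : (1 + δ) • (V.adjoint ∘L T ∘L V) ≤ X := by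
    rw [hcomp T B ε hTi hTj, hK]
    have h1 : ε • (1 - star K * K) ≤ ((1 - t) / 4) • X := by
      have : ε • (1 - star K * K) ≤ ε • (1 : H →L[ℂ] H) :=
        smul_le_smul_of_nonneg_left (sub_le_self _ (star_mul_self_nonneg K)) hε0.le
      refine this.trans ?_
      have e : ε • (1 : H →L[ℂ] H) = ((1 - t) / 4) • (η • (1 : H →L[ℂ] H)) := by
        rw [smul_smul]; congr 1; rw [hε]; ring
      rw [e]
      exact smul_le_smul_of_nonneg_left hηX (by linarith)
    have h2 : (1 + δ) • (t • X + ε • (1 - star K * K)) ≤ (1 + δ) • (t • X + ((1 - t) / 4) • X) :=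
      smul_le_smul_of_nonneg_left (add_le_add le_rfl h1) (by positivity)
    refine h2.trans ?_
    rw [← add_smul, smul_smul]
    calc _ ≤ (1:ℝ) • X := smul_le_smul_of_nonneg_right (by rw [hδ]; nlinarith) hX.nonneg
      _ = X := one_smul _ _
  have hTS := dom V hVV T hTpos.nonneg δ hδ0 X hVTV
  set μ : ℝ := (1 + δ⁻¹) * ‖T‖
  set S : E →L[ℂ] E := V ∘L X ∘L V.adjoint + μ • (1 - V ∘L V.adjoint) with hS
  have hSpos := hTpos.of_le hTS
  have hVx : ∀ x, V.adjoint (V x) = x := fun x => by simpa using congrArg (fun L => L x) hVV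
  have hSV : S ∘L V = V ∘L X := by
    ext1 x; simp [hS, hVx]
  have hmono : cfc f T ≤ cfc f S :=
    hf _ T S hTpos.isSelfAdjoint hSpos.isSelfAdjoint ((spec_iff T).2 hTpos).2 ((spec_iff S).2 hSpos).2 hTS
  have hu : ∀ (Y : H →L[ℂ] H) (Z : E →L[ℂ] E) (W : H →L[ℂ] E),
      IsStrictlyPositive Y → IsStrictlyPositive Z → Z ∘L W = W ∘L Y → cfc f Z ∘L W = W ∘L cfc f Y := by
    intro Y Z W hY hZ h
    refine intertwine f Y Z W hY.isSelfAdjoint hZ.isSelfAdjoint ?_ h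
    exact (hcH Y hY).union_of_isClosed (hcE Z hZ) (spectrum.isClosed Y) (spectrum.isClosed Z)
  have e1 := hu _ _ _ hB hTpos hTi
  have e2 := hu _ _ _ (sp_smul_one hε0) hTpos hTj
  have e3 := hu _ _ _ hX hSpos hSV
  have e4 : cfc f (ε • (1 : H →L[ℂ] H)) = f ε • 1 := by
    rw [← Algebra.algebraMap_eq_smul_one, cfc_algebraMap, Algebra.algebraMap_eq_smul_one]
  rw [e4] at e2
  have e5 := hcomp _ _ _ e1 e2
  have h6 : V.adjoint ∘L cfc f T ∘L V ≤ V.adjoint ∘L cfc f S ∘L V := by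
    simpa using conj_le V.adjoint hmono
  rw [e5, e3, ← ContinuousLinearMap.comp_assoc, hVV, ContinuousLinearMap.one_def, ContinuousLinearMap.id_comp] at h6
  refine le_trans ?_ h6
  exact le_add_of_nonneg_right (smul_nonneg (hpos ε hε0).le hM)


lemma main1 (f : ℝ → ℝ) (hpos : ∀ x ∈ Ioi (0:ℝ), 0 < f x) (hf : OperatorMonotonePos f)
    (hcH : ∀ Y : H →L[ℂ] H, IsStrictlyPositive Y → ContinuousOn f (spectrum ℝ Y))
    (hcE : ∀ Y : WithLp 2 (H × H) →L[ℂ] WithLp 2 (H × H), IsStrictlyPositive Y → ContinuousOn f (spectrum ℝ Y))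
    (A B : H →L[ℂ] H) (hA : IsStrictlyPositive A) (hAB : A ≤ B) :
    cfc (fun t => f t / t) B ≤ cfc (fun t => f t / t) A := by
  obtain ⟨i, j, hii, hjj, hij, hji, hsum⟩ := exists_emb (H := H)
  have hB := hA.of_le hAB
  have hsA : ∀ x ∈ spectrum ℝ A, 0 < x := ((spec_iff A).2 hA).2
  have hsB : ∀ x ∈ spectrum ℝ B, 0 < x := ((spec_iff B).2 hB).2
  have hA' := hA.isSelfAdjoint
  have hB' := hB.isSelfAdjoint
  have cs : ∀ Y : H →L[ℂ] H, ContinuousOn (fun t : ℝ => √t) (spectrum ℝ Y) :=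
    fun Y => Real.continuous_sqrt.continuousOn
  have ci : ∀ Y : H →L[ℂ] H, IsStrictlyPositive Y → ContinuousOn (fun t : ℝ => (√t)⁻¹) (spectrum ℝ Y) :=
    fun Y hY => (cs Y).inv₀ fun x hx => (Real.sqrt_pos.2 (((spec_iff Y).2 hY).2 hx)).ne'
  have conj : ∀ (Y : H →L[ℂ] H) (hY : IsStrictlyPositive Y) (g : ℝ → ℝ), ContinuousOn g (spectrum ℝ Y) →
      cfc (fun t : ℝ => (√t)⁻¹) Y * cfc g Y * cfc (fun t : ℝ => (√t)⁻¹) Y = cfc (fun t => g t / t) Y := by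
    intro Y hY g hg
    rw [← cfc_mul _ _ Y (ci Y hY) hg, ← cfc_mul (fun x => (√x)⁻¹ * g x) _ Y ((ci Y hY).mul hg) (ci Y hY)]
    refine cfc_congr fun x hx => ?_
    have hx0 : 0 < x := ((spec_iff Y).2 hY).2 hx
    have := Real.mul_self_sqrt hx0.le
    have h2 := Real.sqrt_pos.2 hx0
    calc (√x)⁻¹ * g x * (√x)⁻¹ = g x / (√x * √x) := by field_simp
      _ = g x / x := by rw [this]
  have hApp : cfc (fun t : ℝ => √t) A * cfc (fun t : ℝ => √t) A = A := by
    rw [← cfc_mul _ _ A (cs A) (cs A)]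
    conv_rhs => rw [← cfc_id ℝ A hA']
    exact cfc_congr fun x hx => Real.mul_self_sqrt (hsA x hx).le
  have hApm : cfc (fun t : ℝ => √t) A * cfc (fun t : ℝ => (√t)⁻¹) A = 1 := by
    rw [← cfc_mul _ _ A (cs A) (ci A hA), ← cfc_one ℝ A hA']
    exact cfc_congr fun x hx => mul_inv_cancel₀ (Real.sqrt_pos.2 (hsA x hx)).ne'
  have hAmp : cfc (fun t : ℝ => (√t)⁻¹) A * cfc (fun t : ℝ => √t) A = 1 := by
    rw [← hApm]; exact cfc_commute_cfc _ _ _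
  have hBinv : cfc (fun t : ℝ => (√t)⁻¹) B * cfc (fun t : ℝ => (√t)⁻¹) B = cfc (fun t : ℝ => t⁻¹) B := by
    have := conj B hB (fun _ => 1) continuousOn_const
    rw [cfc_const_one ℝ B hB', mul_one] at this
    simpa using this
  have hAinv : cfc (fun t : ℝ => (√t)⁻¹) A * cfc (fun t : ℝ => (√t)⁻¹) A = cfc (fun t : ℝ => t⁻¹) A := by
    have := conj A hA (fun _ => 1) continuousOn_const
    rw [cfc_const_one ℝ A hA', mul_one] at this
    simpa using this
  have hBB : cfc (fun t : ℝ => (√t)⁻¹) B * B * cfc (fun t : ℝ => (√t)⁻¹) B = 1 := by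
    have := conj B hB (fun x => x) continuousOn_id
    rw [cfc_id' ℝ B hB'] at this
    rw [this, ← cfc_one ℝ B hB']
    exact cfc_congr fun x hx => div_self (hsB x hx).ne'
  have hfB := conj B hB f (hcH B hB)
  have hfA := conj A hA f (hcH A hA)
  have hAps : IsSelfAdjoint (cfc (fun t : ℝ => √t) A) := cfc_predicate _ A
  have hAms : IsSelfAdjoint (cfc (fun t : ℝ => (√t)⁻¹) A) := cfc_predicate _ A
  have hBms : IsSelfAdjoint (cfc (fun t : ℝ => (√t)⁻¹) B) := cfc_predicate _ B
  have hinv := inv_anti A B hA hAB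
  set Ap := cfc (fun t : ℝ => √t) A
  set Am := cfc (fun t : ℝ => (√t)⁻¹) A
  set Bm := cfc (fun t : ℝ => (√t)⁻¹) B
  have key : ∀ t : ℝ, 0 < t → t < 1 → t • cfc (fun t => f t / t) B ≤ cfc (fun t => f t / t) A := by
    intro t ht0 ht1
    have hst : √t * √t = t := Real.mul_self_sqrt ht0.le
    have hKs : star (√t • (Bm * Ap)) = √t • (Ap * Bm) := by
      rw [star_smul, star_mul, hAps.star_eq, hBms.star_eq]; simp
    have hgen : ∀ Y, star (√t • (Bm * Ap)) * Y * (√t • (Bm * Ap)) = t • (Ap * (Bm * Y * Bm) * Ap) := by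
      intro Y
      rw [hKs, smul_mul_assoc, smul_mul_assoc, mul_smul_comm, smul_smul, hst]
      simp only [mul_assoc]
    have h := hansen f hpos hf hcH i j hii hjj hij hji hsum hcE B A (√t • (Bm * Ap)) hB hA t ht1 ?_ ?_
    · rw [hgen, hfB] at h
      have h2 := hAms.conjugate_le_conjugate h
      rw [hfA] at h2
      refine le_trans (le_of_eq ?_) h2
      rw [mul_smul_comm, smul_mul_assoc]
      congr 1
      calc cfc (fun t => f t / t) B = 1 * cfc (fun t => f t / t) B * 1 := by rw [one_mul, mul_one]
        _ = _ := by rw [← hAmp]; nth_rewrite 2 [hAmp]; rw [← hApm]; simp only [mul_assoc]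
    · rw [hgen, hBB, mul_one, hApp]
    · have := hgen 1
      rw [mul_one, mul_one, hBinv] at this
      rw [this]
      have h2 : Ap * cfc (fun t : ℝ => t⁻¹) B * Ap ≤ 1 := by
        refine (hAps.conjugate_le_conjugate hinv).trans_eq ?_
        rw [← hAinv]
        calc Ap * (Am * Am) * Ap = (Ap * Am) * (Am * Ap) := by simp only [mul_assoc]
          _ = 1 := by rw [hApm, hAmp, one_mul]
      calc _ ≤ t • (1 : H →L[ℂ] H) := smul_le_smul_of_nonneg_left h2 ht0.le
        _ ≤ (1 : ℝ) • (1 : H →L[ℂ] H) := smul_le_smul_of_nonneg_right ht1.le zero_le_one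
        _ = 1 := one_smul _ _
  have hlim : Filter.Tendsto (fun t : ℝ => t • cfc (fun t => f t / t) B) (nhdsWithin 1 (Iio 1))
      (nhds ((1 : ℝ) • cfc (fun t => f t / t) B)) :=
    ((continuous_id.smul continuous_const).tendsto 1).mono_left nhdsWithin_le_nhds
  rw [one_smul] at hlim
  refine le_of_tendsto hlim ?_
  filter_upwards [Ioo_mem_nhdsLT (zero_lt_one' ℝ)] with t ht
  exact key t ht.1 ht.2

lemma cfc_smul_one (g : ℝ → ℝ) (a : ℝ) : cfc g (a • (1 : H →L[ℂ] H)) = g a • 1 := by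
  rw [← Algebra.algebraMap_eq_smul_one, cfc_algebraMap, Algebra.algebraMap_eq_smul_one]

lemma smul_one_le {x y : ℝ} (h : x ≤ y) : x • (1 : H →L[ℂ] H) ≤ y • (1 : H →L[ℂ] H) :=
  smul_le_smul_of_nonneg_right h zero_le_one

lemma le_of_smul_one {x y : ℝ} (h : x • (1 : ℂ →L[ℂ] ℂ) ≤ y • (1 : ℂ →L[ℂ] ℂ)) : x ≤ y := by
  rw [ContinuousLinearMap.le_def] at h
  have := h.re_inner_nonneg_left 1
  simp at this
  linarith

lemma sp_cont {f : ℝ → ℝ} (hc : ContinuousOn f (Ioi 0)) (Y : E →L[ℂ] E) (hY : IsStrictlyPositive Y) :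
    ContinuousOn f (spectrum ℝ Y) := hc.mono ((spec_iff Y).2 hY).2

lemma cont_f (f : ℝ → ℝ) (hpos : ∀ x ∈ Ioi (0:ℝ), 0 < f x) (hf : OperatorMonotonePos f) :
    ContinuousOn f (Ioi 0) := by
  have hle : ∀ a b : ℝ, a ≤ b → a • (1 : ℂ →L[ℂ] ℂ) ≤ b • (1 : ℂ →L[ℂ] ℂ) := fun a b h =>
    smul_one_le h
  have hmono : ∀ a b : ℝ, 0 < a → a ≤ b → f a ≤ f b := by
    intro a b ha hab
    have ha' := (spec_iff _).2 (sp_smul_one (E := ℂ) ha)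
    have hb' := (spec_iff _).2 (sp_smul_one (E := ℂ) (ha.trans_le hab))
    have := hf ℂ _ _ ha'.1 hb'.1 ha'.2 hb'.2 (hle a b hab)
    rw [cfc_smul_one, cfc_smul_one] at this
    exact le_of_smul_one this
  have hfin : ∀ s : Set ℝ, s.Finite → ContinuousOn f s := fun s hs => by
    rw [continuousOn_iff_continuous_domRestrict]
    have := hs.isDiscrete.to_subtype
    exact continuous_of_discreteTopology
  have hanti : ∀ a b : ℝ, 0 < a → a ≤ b → f b / b ≤ f a / a := by
    intro a b ha hab
    have := main1 (H := ℂ) f hpos hf (fun Y _ => hfin _ (fin_spec Y)) (fun Y _ => hfin _ (fin_spec Y))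
      _ _ (sp_smul_one ha) (hle a b hab)
    rw [cfc_smul_one, cfc_smul_one] at this
    exact le_of_smul_one this
  intro x hx
  have hx : 0 < x := hx
  have hfx := hpos x hx
  refine ContinuousAt.continuousWithinAt ?_
  have l1 : Filter.Tendsto (fun y => f x * min 1 (y / x)) (nhds x) (nhds (f x)) := by
    have : Continuous (fun y => f x * min 1 (y / x)) := by fun_prop
    have := this.tendsto x
    simpa [div_self hx.ne'] using this
  have l2 : Filter.Tendsto (fun y => f x * max 1 (y / x)) (nhds x) (nhds (f x)) := by
    have : Continuous (fun y => f x * max 1 (y / x)) := by fun_prop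
    have := this.tendsto x
    simpa [div_self hx.ne'] using this
  refine tendsto_of_tendsto_of_tendsto_of_le_of_le' l1 l2 ?_ ?_
  · filter_upwards [Ioi_mem_nhds hx] with y hy
    have hy : 0 < y := hy
    rcases le_total x y with h | h
    · have := hmono x y hx h
      have h2 := mul_le_mul_of_nonneg_left (min_le_left 1 (y / x)) hfx.le
      linarith
    · have h1 := hanti y x hy h
      have h2 := mul_le_mul_of_nonneg_left (min_le_right 1 (y / x)) hfx.le
      rw [div_le_div_iff₀ hx hy] at h1
      refine h2.trans ?_
      rw [mul_div_assoc', div_le_iff₀ hx]; exact h1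
  · filter_upwards [Ioi_mem_nhds hx] with y hy
    have hy : 0 < y := hy
    rcases le_total x y with h | h
    · have h1 := hanti x y hx h
      have h2 := mul_le_mul_of_nonneg_left (le_max_right 1 (y / x)) hfx.le
      rw [div_le_div_iff₀ hy hx] at h1
      refine le_trans ?_ h2
      rw [mul_div_assoc', le_div_iff₀ hx]; exact h1
    · have := hmono y x hy h
      have h2 := mul_le_mul_of_nonneg_left (le_max_left 1 (y / x)) hfx.le
      linarith

end

set_option maxHeartbeats 1000000 in
/-- If `f : ℝ⁺ → ℝ⁺` is operator monotone, so are `t ↦ −f(t)/t`, `t ↦ t/f(t)`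
and `t ↦ t·f(1/t)`. -/
theorem operatorMonotone_transforms (f : ℝ → ℝ)
    (hpos : ∀ x ∈ Ioi (0:ℝ), 0 < f x) (hf : OperatorMonotonePos f) :
    OperatorMonotonePos (fun t => -(f t / t)) ∧
      OperatorMonotonePos (fun t => t / f t) ∧
      OperatorMonotonePos (fun t => t * f t⁻¹) := by
  have hc := cont_f f hpos hf
  have hcq : ContinuousOn (fun t => f t / t) (Ioi 0) :=
    hc.div continuousOn_id (fun x hx => (ne_of_gt hx))
  have main : ∀ (H : Type) [NormedAddCommGroup H] [InnerProductSpace ℂ H] [CompleteSpace H]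
      (A B : H →L[ℂ] H), IsStrictlyPositive A → A ≤ B →
      cfc (fun t => f t / t) B ≤ cfc (fun t => f t / t) A := by
    intro H _ _ _ A B hA hAB
    exact main1 f hpos hf (sp_cont (E := H) hc)
      (sp_cont (E := WithLp 2 (H × H)) hc) A B hA hAB
  refine ⟨?_, ?_, ?_⟩
  · intro H _ _ _ A B hA hB sA sB hAB
    have := main H A B ((spec_iff A).1 ⟨hA, sA⟩) hAB
    rw [cfc_neg, cfc_neg]
    exact neg_le_neg this
  · intro H _ _ _ A B hA hB sA sB hAB
    have h := main H A B ((spec_iff A).1 ⟨hA, sA⟩) hAB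
    have hs : IsStrictlyPositive (cfc (fun t => f t / t) B) := by
      rw [← spec_iff]
      refine ⟨cfc_predicate _ B, ?_⟩
      rw [cfc_map_spectrum (fun t => f t / t) B hB (hcq.mono sB)]
      rintro _ ⟨x, hx, rfl⟩
      exact div_pos (hpos x (sB hx)) (sB hx)
    have h2 := inv_anti _ _ hs h
    have e : ∀ Y : H →L[ℂ] H, IsSelfAdjoint Y → spectrum ℝ Y ⊆ Ioi 0 →
        cfc (fun t : ℝ => t⁻¹) (cfc (fun t => f t / t) Y) = cfc (fun t => t / f t) Y := by
      intro Y hY sY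
      rw [← cfc_comp' (fun t : ℝ => t⁻¹) (fun t => f t / t) Y ?_ (hcq.mono sY) hY]
      · simp only [inv_div]
      · refine continuousOn_inv₀.mono ?_
        rintro _ ⟨x, hx, rfl⟩
        exact (div_pos (hpos x (sY hx)) (sY hx)).ne'
    rwa [e A hA sA, e B hB sB] at h2
  · intro H _ _ _ A B hA hB sA sB hAB
    have h := inv_anti A B ((spec_iff A).1 ⟨hA, sA⟩) hAB
    have ci : ∀ Y : H →L[ℂ] H, spectrum ℝ Y ⊆ Ioi 0 →
        ContinuousOn (fun t : ℝ => t⁻¹) (spectrum ℝ Y) := fun Y sY =>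
      continuousOn_inv₀.mono fun x hx => ne_of_gt (sY hx)
    have hs : IsStrictlyPositive (cfc (fun t : ℝ => t⁻¹) B) := by
      rw [← spec_iff]
      refine ⟨cfc_predicate _ B, ?_⟩
      rw [cfc_map_spectrum (fun t : ℝ => t⁻¹) B hB (ci B sB)]
      rintro _ ⟨x, hx, rfl⟩
      exact inv_pos.2 (mem_Ioi.1 (sB hx))
    have h2 := main H _ _ hs h
    have e : ∀ Y : H →L[ℂ] H, IsSelfAdjoint Y → spectrum ℝ Y ⊆ Ioi 0 →
        cfc (fun t => f t / t) (cfc (fun t : ℝ => t⁻¹) Y) = cfc (fun t => t * f t⁻¹) Y := by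
      intro Y hY sY
      rw [← cfc_comp' (fun t => f t / t) (fun t : ℝ => t⁻¹) Y ?_ (ci Y sY) hY]
      · simp only [div_inv_eq_mul, mul_comm]
      · refine hcq.mono ?_
        rintro _ ⟨x, hx, rfl⟩
        exact inv_pos.2 (mem_Ioi.1 (sY hx))
    rwa [e A hA sA, e B hB sB] at h2
end
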